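/- arXiv:1410.8144 — 3 statements merged into one kernel-verified Lean document; each statement's English description precedes it below -/
import Mathlib

section
/- Let a, b, c be positive integers, H = (H_A,H_B,H_C) traceless, and z ∈ ℝ. Suppose there exists ψ ∈ ℋ₀(H,z) such that the tangent map T_ψ : 𝔫₋(H) → ℋ₋(H,z) is surjective. Then ⟨(H,z), λ⟩ ≥ 0 is a valid inequality for the Kronecker cone: for every φ ∈ ℂ^a ⊗ ℂ^b ⊗ ℂ^c one has ⟨(H,z), (spec↓ρ_A(φ), spec↓ρ_B(φ), spec↓ρ_C(φ))⟩ ≥ 0. -/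
open scoped BigOperators

noncomputable section

/-- The reduced density matrix on the first subsystem. -/
def rhoA {a b c : ℕ} (ψ : Fin a × Fin b × Fin c → ℂ) : Matrix (Fin a) (Fin a) ℂ :=
  Matrix.of fun i i' => ∑ j : Fin b, ∑ k : Fin c, ψ (i, j, k) * (starRingEnd ℂ) (ψ (i', j, k))

/-- The reduced density matrix on the second subsystem. -/
def rhoB {a b c : ℕ} (ψ : Fin a × Fin b × Fin c → ℂ) : Matrix (Fin b) (Fin b) ℂ :=
  Matrix.of fun j j' => ∑ i : Fin a, ∑ k : Fin c, ψ (i, j, k) * (starRingEnd ℂ) (ψ (i, j', k))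

/-- The reduced density matrix on the third subsystem. -/
def rhoC {a b c : ℕ} (ψ : Fin a × Fin b × Fin c → ℂ) : Matrix (Fin c) (Fin c) ℂ :=
  Matrix.of fun k k' => ∑ i : Fin a, ∑ j : Fin b, ψ (i, j, k) * (starRingEnd ℂ) (ψ (i, j, k'))

/-- `lam` is the vector of eigenvalues of `ρ`, listed in nonincreasing order
with multiplicity. -/
def IsSpecDown {n : ℕ} (ρ : Matrix (Fin n) (Fin n) ℂ) (lam : Fin n → ℝ) : Prop :=
  Antitone lam ∧ ∃ (hρ : ρ.IsHermitian) (σ : Equiv.Perm (Fin n)), lam = hρ.eigenvalues ∘ σ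

/-- The Kronecker cone `C(a,b,c)`. -/
def KronCone (a b c : ℕ) : Set ((Fin a → ℝ) × (Fin b → ℝ) × (Fin c → ℝ)) :=
  { lam | ∃ ψ : Fin a × Fin b × Fin c → ℂ,
      IsSpecDown (rhoA ψ) lam.1 ∧ IsSpecDown (rhoB ψ) lam.2.1 ∧ IsSpecDown (rhoC ψ) lam.2.2 }

/-- The pairing `⟨(H,z), λ⟩`. -/
def wtPair {a b c : ℕ} (HA : Fin a → ℝ) (HB : Fin b → ℝ) (HC : Fin c → ℝ) (z : ℝ)
    (lam : (Fin a → ℝ) × (Fin b → ℝ) × (Fin c → ℝ)) : ℝ :=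
  (∑ i, HA i * lam.1 i) + (∑ j, HB j * lam.2.1 j) + (∑ k, HC k * lam.2.2 k)
    + z * ∑ i, lam.1 i

/-- `H = (H_A, H_B, H_C)` is traceless. -/
def Traceless {a b c : ℕ} (HA : Fin a → ℝ) (HB : Fin b → ℝ) (HC : Fin c → ℝ) : Prop :=
  (∑ i, HA i) = 0 ∧ (∑ j, HB j) = 0 ∧ (∑ k, HC k) = 0

/-- `(H, z)` is a facet normal of the Kronecker cone `C(a,b,c)`. -/
def IsFacetNormal (a b c : ℕ) (HA : Fin a → ℝ) (HB : Fin b → ℝ) (HC : Fin c → ℝ)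
    (z : ℝ) : Prop :=
  Traceless HA HB HC ∧ ¬(HA = 0 ∧ HB = 0 ∧ HC = 0 ∧ z = 0) ∧
  (∀ lam ∈ KronCone a b c, 0 ≤ wtPair HA HB HC z lam) ∧
  Module.finrank ℝ
    (affineSpan ℝ {lam ∈ KronCone a b c | wtPair HA HB HC z lam = 0}).direction
    = a + b + c - 3

/-- `(H, z)` is a trivial (Weyl chamber) normal. -/
def IsTrivialNormal {a b c : ℕ} (HA : Fin a → ℝ) (HB : Fin b → ℝ) (HC : Fin c → ℝ)
    (z : ℝ) : Prop :=
  ∃ t : ℝ, 0 < t ∧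
    ((∃ i i' : Fin a, i < i' ∧ HA = t • (Pi.single i 1 - Pi.single i' 1) ∧
        HB = 0 ∧ HC = 0 ∧ z = 0) ∨
     (∃ j j' : Fin b, j < j' ∧ HB = t • (Pi.single j 1 - Pi.single j' 1) ∧
        HA = 0 ∧ HC = 0 ∧ z = 0) ∨
     (∃ k k' : Fin c, k < k' ∧ HC = t • (Pi.single k 1 - Pi.single k' 1) ∧
        HA = 0 ∧ HB = 0 ∧ z = 0))

/-- The subspace of vectors supported on coordinates satisfying `P`. -/
def suppSubmodule {ι : Type*} (P : ι → Prop) : Submodule ℂ (ι → ℂ) where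
  carrier := {ψ | ∀ p, ¬ P p → ψ p = 0}
  add_mem' := by
    intro x y hx hy p hp
    simp only [Pi.add_apply, hx p hp, hy p hp, add_zero]
  zero_mem' := by intro p _; rfl
  smul_mem' := by
    intro r x hx p hp
    simp only [Pi.smul_apply, hx p hp, smul_zero]

/-- The zero-weight space `ℋ₀(H,z)`. -/
def weight0Space {a b c : ℕ} (HA : Fin a → ℝ) (HB : Fin b → ℝ) (HC : Fin c → ℝ)
    (z : ℝ) : Submodule ℂ (Fin a × Fin b × Fin c → ℂ) :=
  suppSubmodule fun p => HA p.1 + HB p.2.1 + HC p.2.2 + z = 0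

/-- The negative-weight space `ℋ₋(H,z)`. -/
def weightNegSpace {a b c : ℕ} (HA : Fin a → ℝ) (HB : Fin b → ℝ) (HC : Fin c → ℝ)
    (z : ℝ) : Submodule ℂ (Fin a × Fin b × Fin c → ℂ) :=
  suppSubmodule fun p => HA p.1 + HB p.2.1 + HC p.2.2 + z < 0

/-- Strictly lower triangular matrices `X` with `X i' i = 0` unless
`i < i'` and `Hv i' < Hv i`. -/
def lowerMod {d : ℕ} (Hv : Fin d → ℝ) : Submodule ℂ (Matrix (Fin d) (Fin d) ℂ) where
  carrier := {X | ∀ i' i, ¬ (i < i' ∧ Hv i' < Hv i) → X i' i = 0}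
  add_mem' := by
    intro X Y hX hY i' i h
    simp only [Matrix.add_apply, hX i' i h, hY i' i h, add_zero]
  zero_mem' := by intro i' i h; rfl
  smul_mem' := by
    intro r X hX i' i h
    simp only [Matrix.smul_apply, hX i' i h, smul_zero]

/-- The nilpotent algebra `𝔫₋(H)`. -/
def nMinusMod {a b c : ℕ} (HA : Fin a → ℝ) (HB : Fin b → ℝ) (HC : Fin c → ℝ) :
    Submodule ℂ (Matrix (Fin a) (Fin a) ℂ × Matrix (Fin b) (Fin b) ℂ ×
      Matrix (Fin c) (Fin c) ℂ) :=
  (lowerMod HA).prod ((lowerMod HB).prod (lowerMod HC))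

/-- The infinitesimal action `(X,Y,Z) ↦ (X⊗I⊗I + I⊗Y⊗I + I⊗I⊗Z)ψ`. -/
def act {a b c : ℕ}
    (t : Matrix (Fin a) (Fin a) ℂ × Matrix (Fin b) (Fin b) ℂ × Matrix (Fin c) (Fin c) ℂ)
    (ψ : Fin a × Fin b × Fin c → ℂ) : Fin a × Fin b × Fin c → ℂ := fun p =>
  (∑ i', t.1 p.1 i' * ψ (i', p.2.1, p.2.2)) +
  (∑ j', t.2.1 p.2.1 j' * ψ (p.1, j', p.2.2)) +
  (∑ k', t.2.2 p.2.2 k' * ψ (p.1, p.2.1, k'))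

/-- The action as a linear map in `(X,Y,Z)`. -/
def actL {a b c : ℕ} (ψ : Fin a × Fin b × Fin c → ℂ) :
    (Matrix (Fin a) (Fin a) ℂ × Matrix (Fin b) (Fin b) ℂ × Matrix (Fin c) (Fin c) ℂ)
      →ₗ[ℂ] (Fin a × Fin b × Fin c → ℂ) where
  toFun t := act t ψ
  map_add' t s := by
    funext p
    simp only [act, Prod.fst_add, Prod.snd_add, Matrix.add_apply, add_mul,
      Finset.sum_add_distrib, Pi.add_apply]
    ring
  map_smul' r t := by
    funext p
    simp only [act, Prod.smul_fst, Prod.smul_snd, Matrix.smul_apply, smul_eq_mul,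
      Pi.smul_apply, RingHom.id_apply, Finset.mul_sum, mul_assoc, mul_add]

/-- The tangent map `T_ψ : 𝔫₋(H) → ℋ₋(H,z)` is a linear isomorphism. -/
def TangentIso {a b c : ℕ} (HA : Fin a → ℝ) (HB : Fin b → ℝ) (HC : Fin c → ℝ)
    (z : ℝ) (ψ : Fin a × Fin b × Fin c → ℂ) : Prop :=
  ∃ h : ∀ t ∈ nMinusMod HA HB HC, actL ψ t ∈ weightNegSpace HA HB HC z,
    Function.Bijective ((actL ψ).restrict h)

/-- The tangent map `T_ψ : 𝔫₋(H) → ℋ₋(H,z)` is surjective. -/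
def TangentSurj {a b c : ℕ} (HA : Fin a → ℝ) (HB : Fin b → ℝ) (HC : Fin c → ℝ)
    (z : ℝ) (ψ : Fin a × Fin b × Fin c → ℂ) : Prop :=
  ∃ h : ∀ t ∈ nMinusMod HA HB HC, actL ψ t ∈ weightNegSpace HA HB HC z,
    Function.Surjective ((actL ψ).restrict h)

/-- `(H,z)` is admissible: the hyperplane `⟨(H,z), ·⟩ = 0` in `V` is spanned by
the weights of zero `(H,z)`-weight. -/
def Admissible {a b c : ℕ} (HA : Fin a → ℝ) (HB : Fin b → ℝ) (HC : Fin c → ℝ)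
    (z : ℝ) : Prop :=
  (Submodule.span ℝ
    { w : (Fin a → ℝ) × (Fin b → ℝ) × (Fin c → ℝ) |
      ∃ i j k, HA i + HB j + HC k + z = 0 ∧
        w = (Pi.single i 1, Pi.single j 1, Pi.single k 1) } : Set _)
  = { lam | (∑ i, lam.1 i) = (∑ j, lam.2.1 j) ∧ (∑ i, lam.1 i) = (∑ k, lam.2.2 k) ∧
        wtPair HA HB HC z lam = 0 }

/-- `(H,z)` is a Ressayre element. -/
def IsRessayre {a b c : ℕ} (HA : Fin a → ℝ) (HB : Fin b → ℝ) (HC : Fin c → ℝ)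
    (z : ℝ) : Prop :=
  Traceless HA HB HC ∧ ¬(HA = 0 ∧ HB = 0 ∧ HC = 0 ∧ z = 0) ∧
  Admissible HA HB HC z ∧
  ∃ ψ ∈ weight0Space HA HB HC z, TangentIso HA HB HC z ψ

/-- `(H_A, H_B)` satisfies the extremal-edge condition. -/
def ExtremalEdge {a b : ℕ} (HA : Fin a → ℝ) (HB : Fin b → ℝ) : Prop :=
  (∑ i, HA i) = 0 ∧ (∑ j, HB j) = 0 ∧ ¬(HA = 0 ∧ HB = 0) ∧
  ∀ (x : Fin a → ℝ) (y : Fin b → ℝ), (∑ i, x i) = 0 → (∑ j, y j) = 0 →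
    (∀ i j k l, HA i + HB j = HA k + HB l → x i + y j = x k + y l) →
    ∃ t : ℝ, x = t • HA ∧ y = t • HB

theorem MvPolynomial.exists_ne_zero_forall_eval_ne_zero_exists_eval_eq
    {K σ τ : Type*} [Field K] [IsAlgClosed K] [Finite σ] [Finite τ]
    (θ : σ → MvPolynomial τ K) (hθ : Function.Injective (MvPolynomial.aeval (R := K) θ)) :
    ∃ u : MvPolynomial σ K, u ≠ 0 ∧ ∀ y : σ → K, MvPolynomial.eval y u ≠ 0 →
      ∃ x : τ → K, ∀ i, MvPolynomial.eval x (θ i) = y i := by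
  set f : MvPolynomial σ K →+* MvPolynomial τ K := (MvPolynomial.aeval θ).toRingHom with hf
  have hfp : f.FinitePresentation := by
    rw [← RingHom.FinitePresentation.of_finiteType]
    refine RingHom.FiniteType.of_comp_finiteType (f := MvPolynomial.C) ?_
    have : f.comp MvPolynomial.C = algebraMap K (MvPolynomial τ K) := by
      ext x; simp [hf]
    rw [this, RingHom.finiteType_algebraMap]
    infer_instance
  obtain ⟨T, hT⟩ := PrimeSpectrum.exists_constructibleSetData_iff.mpr
    (PrimeSpectrum.isConstructible_range_comap hfp)
  have hbot : (⊥ : PrimeSpectrum (MvPolynomial σ K)) ∈ T.toSet := by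
    rw [hT]
    refine ⟨⊥, ?_⟩
    ext x
    exact map_eq_zero_iff _ hθ
  simp only [PrimeSpectrum.ConstructibleSetData.toSet, Set.mem_iUnion] at hbot
  obtain ⟨C, hC, hbC⟩ := hbot
  have hCf : C.f ≠ 0 := by
    rintro h
    exact hbC.2 (by simp [h])
  have hCg : ∀ i, C.g i = 0 := fun i => by
    simpa using hbC.1 (Set.mem_range_self i)
  refine ⟨C.f, hCf, fun y hy => ?_⟩
  let m : PrimeSpectrum (MvPolynomial σ K) :=
    ⟨RingHom.ker (MvPolynomial.eval y), RingHom.ker_isPrime _⟩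
  have hm : m ∈ T.toSet := by
    simp only [PrimeSpectrum.ConstructibleSetData.toSet, Set.mem_iUnion]
    refine ⟨C, hC, ?_, ?_⟩
    · rintro _ ⟨i, rfl⟩
      simp [hCg]
    · simpa [m, RingHom.mem_ker] using hy
  rw [hT] at hm
  obtain ⟨q, hq⟩ := hm
  obtain ⟨M, hM, hqM⟩ := Ideal.exists_le_maximal q.asIdeal q.2.ne_top
  obtain ⟨x, rfl⟩ := MvPolynomial.isMaximal_iff_eq_vanishingIdeal_singleton |>.1 hM
  refine ⟨x, fun i => ?_⟩
  have h1 : MvPolynomial.X i - MvPolynomial.C (y i) ∈ m.asIdeal := by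
    simp [m, RingHom.mem_ker]
  rw [← hq] at h1
  have h2 := hqM h1
  rw [MvPolynomial.mem_vanishingIdeal_singleton_iff] at h2
  simpa [hf, sub_eq_zero, MvPolynomial.coe_aeval_eq_eval] using h2

/-- The common zeros of a nonzero polynomial over `ℂ` have empty interior. -/
theorem MvPolynomial.eq_zero_of_eventually_eval_eq_zero {σ : Type*} [Finite σ]
    {p : MvPolynomial σ ℂ} {x : σ → ℂ} (h : ∀ᶠ y in nhds x, MvPolynomial.eval y p = 0) :
    p = 0 := by
  have := Fintype.ofFinite σ
  obtain ⟨ε, hε, hball⟩ := Metric.eventually_nhds_iff_ball.1 h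
  refine MvPolynomial.funext_set (fun i => Metric.ball (x i) ε)
    (fun i => infinite_of_mem_nhds (x i) (Metric.ball_mem_nhds _ hε)) fun y hy => ?_
  rw [map_zero]
  refine hball y ?_
  rwa [ball_pi _ hε]

theorem MvPolynomial.dense_range_eval_of_mem_nhds {σ τ : Type*} [Finite σ] [Finite τ]
    (θ : σ → MvPolynomial τ ℂ) (y : σ → ℂ)
    (h : Set.range (fun (x : τ → ℂ) i => MvPolynomial.eval x (θ i)) ∈ nhds y) :
    DenseRange (fun (x : τ → ℂ) i => MvPolynomial.eval x (θ i)) := by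
  have hinj : Function.Injective (MvPolynomial.aeval (R := ℂ) θ) := by
    rw [injective_iff_map_eq_zero]
    intro p hp
    refine MvPolynomial.eq_zero_of_eventually_eval_eq_zero (x := y) ?_
    filter_upwards [h]
    rintro _ ⟨x, rfl⟩
    have := congrArg (MvPolynomial.eval x) hp
    rwa [map_zero, MvPolynomial.aeval_def, MvPolynomial.algebraMap_eq, MvPolynomial.eval_eval₂,
      show (MvPolynomial.eval x).comp MvPolynomial.C = RingHom.id ℂ by ext; simp] at this
  obtain ⟨u, hu, hx⟩ :=
    MvPolynomial.exists_ne_zero_forall_eval_ne_zero_exists_eval_eq θ hinj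
  intro z
  rw [mem_closure_iff_frequently]
  intro hz
  refine hu (MvPolynomial.eq_zero_of_eventually_eval_eq_zero (x := z) ?_)
  filter_upwards [hz] with w hw
  by_contra hne
  obtain ⟨x, hx⟩ := hx w hne
  exact hw ⟨x, _root_.funext hx⟩

section LowerUnipotent

open scoped Kronecker Matrix

/-- The strictly lower triangular part of a matrix. -/
def strictLower {R : Type*} [Zero R] {n : ℕ} (X : Matrix (Fin n) (Fin n) R) :
    Matrix (Fin n) (Fin n) R :=
  Matrix.of fun i j => if j < i then X i j else 0

theorem strictLower_eq_self {n : ℕ} {Hv : Fin n → ℝ} {X : Matrix (Fin n) (Fin n) ℂ}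
    (hX : X ∈ lowerMod Hv) : strictLower X = X := by
  ext i j
  by_cases h : j < i
  · simp [strictLower, h]
  · simpa [strictLower, h] using (hX i j fun h' => h h'.1).symm

/-- The restriction of `y` to the coordinates of nonnegative weight. -/
def nonnegPart {R : Type*} [Zero R] {a b c : ℕ} (HA : Fin a → ℝ) (HB : Fin b → ℝ)
    (HC : Fin c → ℝ) (z : ℝ) (y : Fin a × Fin b × Fin c → R) : Fin a × Fin b × Fin c → R :=
  open Classical in fun p => if 0 ≤ HA p.1 + HB p.2.1 + HC p.2.2 + z then y p else 0

/-- The action of a triple of lower unipotent matrices, given by their strictly lower triangular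
parts, on a vector of nonnegative weight. -/
def lowerOrbitMap {R : Type*} [CommRing R] {a b c : ℕ} (HA : Fin a → ℝ) (HB : Fin b → ℝ)
    (HC : Fin c → ℝ) (z : ℝ) (X : Matrix (Fin a) (Fin a) R) (Y : Matrix (Fin b) (Fin b) R)
    (Z : Matrix (Fin c) (Fin c) R) (y : Fin a × Fin b × Fin c → R) :
    Fin a × Fin b × Fin c → R :=
  ((1 + strictLower X) ⊗ₖ ((1 + strictLower Y) ⊗ₖ (1 + strictLower Z))) *ᵥ
    nonnegPart HA HB HC z y

/-- Index set for the coordinates of triples of square matrices together with a tensor. -/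
abbrev OrbitIndex (a b c : ℕ) : Type :=
  (Fin a × Fin a) ⊕ (Fin b × Fin b) ⊕ (Fin c × Fin c) ⊕ (Fin a × Fin b × Fin c)

variable {a b c : ℕ}

/-- `lowerOrbitMap` in terms of a single coordinate vector. -/
def lowerOrbitCoord {R : Type*} [CommRing R] (HA : Fin a → ℝ) (HB : Fin b → ℝ)
    (HC : Fin c → ℝ) (z : ℝ) (x : OrbitIndex a b c → R) : Fin a × Fin b × Fin c → R :=
  lowerOrbitMap HA HB HC z (.of fun i j => x (.inl (i, j))) (.of fun i j => x (.inr (.inl (i, j))))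
    (.of fun i j => x (.inr (.inr (.inl (i, j))))) (fun p => x (.inr (.inr (.inr p))))

theorem map_lowerOrbitCoord {R S : Type*} [CommRing R] [CommRing S] (f : R →+* S)
    (HA : Fin a → ℝ) (HB : Fin b → ℝ) (HC : Fin c → ℝ) (z : ℝ) (x : OrbitIndex a b c → R)
    (p : Fin a × Fin b × Fin c) :
    f (lowerOrbitCoord HA HB HC z x p) = lowerOrbitCoord HA HB HC z (f ∘ x) p := by
  simp [lowerOrbitCoord, lowerOrbitMap, Matrix.mulVec, dotProduct, strictLower, nonnegPart,
    Matrix.one_apply, apply_ite f]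

theorem sum_kronecker_derivative (X : Matrix (Fin a) (Fin a) ℂ) (Y : Matrix (Fin b) (Fin b) ℂ)
    (Z : Matrix (Fin c) (Fin c) ℂ) (ψ y : Fin a × Fin b × Fin c → ℂ) (p : Fin a × Fin b × Fin c) :
    HasDerivAt (fun s : ℂ =>
      (((1 + s • X) ⊗ₖ ((1 + s • Y) ⊗ₖ (1 + s • Z))) *ᵥ (ψ + s • y)) p)
      (act (X, Y, Z) ψ p + y p) 0 := by
  have key : ∀ u v : ℂ, HasDerivAt (fun s : ℂ => u + s * v) v 0 := fun u v => by
    simpa using ((hasDerivAt_id (0 : ℂ)).mul_const v).const_add u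
  have := HasDerivAt.fun_sum (u := Finset.univ) fun q (_ : q ∈ Finset.univ) =>
    ((key ((1 : Matrix _ _ ℂ) p.1 q.1) (X p.1 q.1)).fun_mul
      ((key ((1 : Matrix _ _ ℂ) p.2.1 q.2.1) (Y p.2.1 q.2.1)).fun_mul
        (key ((1 : Matrix _ _ ℂ) p.2.2 q.2.2) (Z p.2.2 q.2.2)))).fun_mul (key (ψ q) (y q))
  convert! this using 1
  simp only [zero_mul, add_zero, add_mul, mul_add, Finset.sum_add_distrib, act,
    Fintype.sum_prod_type, Matrix.one_apply, ite_mul, mul_ite, one_mul, mul_one, mul_zero,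
    Finset.sum_ite_eq, Finset.mem_univ, if_true, Finset.sum_ite_irrel, Finset.sum_const_zero]
  rw [← add_assoc]

theorem denseRange_lowerOrbitCoord {HA : Fin a → ℝ} {HB : Fin b → ℝ} {HC : Fin c → ℝ} {z : ℝ}
    {ψ : Fin a × Fin b × Fin c → ℂ} (hψ : ψ ∈ weight0Space HA HB HC z)
    (hsurj : TangentSurj HA HB HC z ψ) :
    DenseRange (lowerOrbitCoord (R := ℂ) HA HB HC z) := by
  set θ : Fin a × Fin b × Fin c → MvPolynomial (OrbitIndex a b c) ℂ :=
    lowerOrbitCoord HA HB HC z MvPolynomial.X with hθ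
  have heval : (fun (x : OrbitIndex a b c → ℂ) p => MvPolynomial.eval x (θ p)) =
      lowerOrbitCoord HA HB HC z := by
    ext x p
    rw [hθ, map_lowerOrbitCoord]
    exact congrArg (lowerOrbitCoord HA HB HC z · p) (by ext; simp)
  rw [← heval]
  refine MvPolynomial.dense_range_eval_of_mem_nhds θ ψ ?_
  set x₀ : OrbitIndex a b c → ℂ := Sum.elim 0 (Sum.elim 0 (Sum.elim 0 ψ)) with hx₀
  have hpos : nonnegPart HA HB HC z ψ = ψ := by
    ext p
    by_cases h : 0 ≤ HA p.1 + HB p.2.1 + HC p.2.2 + z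
    · simp [nonnegPart, h]
    · simpa [nonnegPart, h] using (hψ p fun h' => h h'.ge).symm
  have hx₀ψ : lowerOrbitCoord HA HB HC z x₀ = ψ := by
    have h0 : ∀ n, strictLower (Matrix.of fun _ _ : Fin n => (0 : ℂ)) = 0 := fun n => by
      ext; simp [strictLower]
    simp [lowerOrbitCoord, lowerOrbitMap, hx₀, h0, hpos]
  have hF : AnalyticAt ℂ (lowerOrbitCoord (R := ℂ) HA HB HC z) x₀ := by
    rw [← heval]
    exact AnalyticAt.pi fun p => AnalyticOnNhd.eval_mvPolynomial (θ p) x₀ trivial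
  have hd := hF.hasStrictFDerivAt
  have hline : ∀ v : OrbitIndex a b c → ℂ, ∀ p,
      fderiv ℂ (lowerOrbitCoord (R := ℂ) HA HB HC z) x₀ v p =
      act (strictLower (.of fun i j => v (.inl (i, j))),
        strictLower (.of fun i j => v (.inr (.inl (i, j)))),
        strictLower (.of fun i j => v (.inr (.inr (.inl (i, j)))))) ψ p +
      nonnegPart HA HB HC z (fun p => v (.inr (.inr (.inr p)))) p := by
    intro v p
    have h1 := hasDerivAt_pi.1 (hd.hasFDerivAt.hasLineDerivAt v) p
    refine h1.unique ?_
    refine (sum_kronecker_derivative _ _ _ ψ _ p).congr_of_eventuallyEq (.of_forall fun s => ?_)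
    have hl : ∀ n (X : Matrix (Fin n) (Fin n) ℂ),
        strictLower (s • X) = s • strictLower X := fun n X => by
      ext i j; simp [strictLower]
    have hp : ∀ y : Fin a × Fin b × Fin c → ℂ,
        nonnegPart HA HB HC z (ψ + s • y) = ψ + s • nonnegPart HA HB HC z y := by
      intro y
      conv_rhs => rw [← hpos]
      ext p
      by_cases h : 0 ≤ HA p.1 + HB p.2.1 + HC p.2.2 + z <;> simp [nonnegPart, h]
    simp only [← hl, ← hp]
    simp only [lowerOrbitCoord, lowerOrbitMap, hx₀, Pi.add_apply, Pi.smul_apply, Sum.elim_inl,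
      Sum.elim_inr, Pi.zero_apply, zero_add]
    rfl
  have hrange : (fderiv ℂ (lowerOrbitCoord (R := ℂ) HA HB HC z) x₀).range = ⊤ := by
    rw [LinearMap.range_eq_top]
    intro y
    obtain ⟨hmem, hs⟩ := hsurj
    obtain ⟨⟨⟨X, Y, Z⟩, ht⟩, hty⟩ := hs ⟨y - nonnegPart HA HB HC z y, fun p hp => by
      simp [nonnegPart, not_lt.1 hp]⟩
    have hact : act (X, Y, Z) ψ = y - nonnegPart HA HB HC z y := congrArg Subtype.val hty
    refine ⟨Sum.elim (fun p => X p.1 p.2) (Sum.elim (fun p => Y p.1 p.2)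
      (Sum.elim (fun p => Z p.1 p.2) y)), ?_⟩
    ext p
    refine (hline _ p).trans ?_
    have hX := strictLower_eq_self ht.1
    have hY := strictLower_eq_self ht.2.1
    have hZ := strictLower_eq_self ht.2.2
    change act (strictLower X, strictLower Y, strictLower Z) ψ p + nonnegPart HA HB HC z y p = y p
    simp only at hX hY hZ
    rw [hX, hY, hZ, hact]
    simp
  have := hd.map_nhds_eq_of_surj hrange
  rw [heval, ← hx₀ψ, ← this]
  exact Filter.range_mem_map

end LowerUnipotent

section GramSchmidt

open scoped Matrix

/-- Gram–Schmidt orthonormalisation of the columns of a matrix. -/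
theorem Matrix.exists_gramSchmidt {n ι : Type*} [Fintype n] [DecidableEq n] [Fintype ι]
    [LinearOrder ι] (M : Matrix n ι ℂ) (hM : LinearIndependent ℂ M.col) :
    ∃ (W : Matrix n ι ℂ) (S : Matrix ι ι ℂ), Wᴴ * W = 1 ∧ W = M * S ∧
      (∀ i j, j < i → S i j = 0) ∧ ∀ i j, j < i → (Wᴴ * M) i j = 0 := by
  classical
  let : LocallyFiniteOrderBot ι :=
    LocallyFiniteOrderBot.ofIic ι (fun a => Finset.univ.filter (· ≤ a)) (by simp)
  set v : ι → EuclideanSpace ℂ n := fun i => WithLp.toLp 2 (M.col i) with hv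
  have hvi : LinearIndependent ℂ v :=
    hM.map' (WithLp.linearEquiv 2 ℂ (n → ℂ)).symm.toLinearMap (LinearEquiv.ker _)
  set w := InnerProductSpace.gramSchmidtNormed ℂ v with hw
  have hwo : Orthonormal ℂ w := InnerProductSpace.gramSchmidtNormed_orthonormal hvi
  have hspan : ∀ i, ∃ c : ι → ℂ, (∀ j, i < j → c j = 0) ∧ w i = ∑ j, c j • v j := by
    intro i
    have h1 : w i ∈ Submodule.span ℂ (v '' Set.Iic i) := by
      rw [hw, InnerProductSpace.gramSchmidtNormed]
      exact Submodule.smul_mem _ _ (InnerProductSpace.gramSchmidt_mem_span ℂ v le_rfl)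
    rw [Finsupp.mem_span_image_iff_linearCombination] at h1
    obtain ⟨l, hl, hlw⟩ := h1
    refine ⟨l, fun j hj => ?_, ?_⟩
    · by_contra h
      exact absurd ((Finsupp.mem_supported _ _).1 hl (Finsupp.mem_support_iff.2 h)) (not_le.2 hj)
    · rw [← hlw, Finsupp.linearCombination_apply, Finsupp.sum_fintype _ _ (by simp)]
  choose c hc0 hc using hspan
  have hinner : ∀ x y : EuclideanSpace ℂ n, inner ℂ x y = ∑ k, star (x k) * y k := fun x y => by
    simp [PiLp.inner_apply, mul_comm]
  refine ⟨.of fun k i => w i k, .of fun i j => c j i, ?_, ?_, fun i j h => hc0 j i h, ?_⟩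
  · ext i j
    have := orthonormal_iff_ite.1 hwo i j
    rw [hinner] at this
    simpa [Matrix.mul_apply, Matrix.one_apply] using this
  · ext k i
    have := congrArg (fun x : EuclideanSpace ℂ n => x k) (hc i)
    simpa [Matrix.mul_apply, hv, mul_comm] using this
  · intro i j h
    have h1 : inner ℂ (w i) (v j) = 0 := by
      rw [hw, InnerProductSpace.gramSchmidtNormed, inner_smul_left,
        InnerProductSpace.gramSchmidt_inv_triangular ℂ v h, mul_zero]
    rw [hinner] at h1
    simpa [Matrix.mul_apply, hv] using h1

/-- Two matrices with orthonormal columns and the same column span (of full dimension) define the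
same orthogonal projection. -/
theorem Matrix.mul_conjTranspose_eq_of_orthonormal {n ι : Type*} [Fintype n] [Fintype ι]
    [DecidableEq ι] {M Q W : Matrix n ι ℂ} {R S : Matrix ι ι ℂ} (hQ : Qᴴ * Q = 1)
    (hW : Wᴴ * W = 1) (hQM : Q = M * R) (hWM : W = M * S) : Q * Qᴴ = W * Wᴴ := by
  have hS : S * (Wᴴ * M) = 1 := by
    rw [mul_eq_one_comm, Matrix.mul_assoc, ← hWM, hW]
  have hQW : Q = W * ((Wᴴ * M) * R) := by
    rw [hWM, ← Matrix.mul_assoc, Matrix.mul_assoc M, ← hWM, hS, Matrix.mul_one, hQM]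
  set T := (Wᴴ * M) * R
  have hT : T * Tᴴ = 1 := by
    rw [mul_eq_one_comm]
    rw [hQW, Matrix.conjTranspose_mul, Matrix.mul_assoc, ← Matrix.mul_assoc Wᴴ, hW,
      Matrix.one_mul] at hQ
    exact hQ
  rw [hQW, Matrix.conjTranspose_mul, Matrix.mul_assoc, ← Matrix.mul_assoc T, hT, Matrix.one_mul]

theorem det_one_add_strictLower {n : ℕ} (X : Matrix (Fin n) (Fin n) ℂ) :
    (1 + strictLower X).det = 1 := by
  rw [Matrix.det_of_isLowerTriangular]
  · simp [strictLower]
  · intro i j h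
    have h' : i < j := h
    simp [strictLower, h'.not_gt, h'.ne]

theorem one_add_strictLower_apply_eq_zero {n : ℕ} (X : Matrix (Fin n) (Fin n) ℂ) {i j : Fin n}
    (h : i < j) : (1 + strictLower X) i j = 0 := by
  simp [strictLower, h.not_gt, h.ne]

theorem linearIndependent_col_one_add_strictLower {n : ℕ} (X : Matrix (Fin n) (Fin n) ℂ) :
    LinearIndependent ℂ (1 + strictLower X).col := by
  rw [Matrix.linearIndependent_cols_iff_isUnit, Matrix.isUnit_iff_isUnit_det,
    det_one_add_strictLower]
  exact isUnit_one

/-- Rayleigh-type bound on the trace of an antitone diagonal matrix over a subspace in the Schubert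
cell with pivots `s`. -/
theorem sum_antitone_mul_normSq_le {n : ℕ} (X : Matrix (Fin n) (Fin n) ℂ) (s : Finset (Fin n))
    {Q : Matrix (Fin n) s ℂ} {R : Matrix s s ℂ} (hQ : Qᴴ * Q = 1)
    (hR : Q = (1 + strictLower X).submatrix id Subtype.val * R) {lam : Fin n → ℝ}
    (hlam : Antitone lam) :
    ∑ i : s, ∑ j, lam j * ‖Q j i‖ ^ 2 ≤ ∑ i : s, lam i := by
  set M : Matrix (Fin n) s ℂ := (1 + strictLower X).submatrix id Subtype.val with hM
  have hind : LinearIndependent ℂ M.col :=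
    (linearIndependent_col_one_add_strictLower X).comp Subtype.val Subtype.val_injective
  obtain ⟨W, S, hW, hWS, hS, -⟩ :=
    Matrix.exists_gramSchmidt (ι := (s : Type)ᵒᵈ) (M.submatrix id OrderDual.ofDual) hind
  set W' : Matrix (Fin n) s ℂ := W.submatrix id OrderDual.toDual with hW'
  have hW'1 : W'ᴴ * W' = 1 := by
    ext i j
    exact congrFun (congrFun hW (OrderDual.toDual i)) (OrderDual.toDual j)
  have hW'S : W' = M * S.submatrix OrderDual.toDual OrderDual.toDual := by
    ext i j
    exact congrFun (congrFun hWS i) (OrderDual.toDual j)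
  have hproj := Matrix.mul_conjTranspose_eq_of_orthonormal hQ hW'1 hR hW'S
  have hsq : ∀ (V : Matrix (Fin n) s ℂ) j, ((∑ i, ‖V j i‖ ^ 2 : ℝ) : ℂ) = (V * Vᴴ) j j := by
    intro V j
    simp [Matrix.mul_apply, Complex.mul_conj']
  have hsum : ∀ j, ∑ i, ‖Q j i‖ ^ 2 = ∑ i, ‖W' j i‖ ^ 2 := fun j => by
    have := hsq Q j
    rw [hproj, ← hsq W' j] at this
    exact_mod_cast this
  have hzero : ∀ (j : Fin n) (i : s), j < i → W' j i = 0 := by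
    intro j i hji
    rw [hW'S, Matrix.mul_apply]
    refine Finset.sum_eq_zero fun k _ => ?_
    rcases lt_or_ge (k : Fin n) i with hk | hk
    · rw [Matrix.submatrix_apply, hS _ _ (OrderDual.toDual_lt_toDual.2 hk), mul_zero]
    · exact mul_eq_zero_of_left (one_add_strictLower_apply_eq_zero X (hji.trans_le hk)) _
  have hunit : ∀ i, ∑ j, ‖W' j i‖ ^ 2 = 1 := fun i => by
    have := congrFun (congrFun hW'1 i) i
    simp only [Matrix.mul_apply, Matrix.conjTranspose_apply, RCLike.star_def, Complex.conj_mul',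
      Matrix.one_apply_eq] at this
    exact_mod_cast this
  calc ∑ i : s, ∑ j, lam j * ‖Q j i‖ ^ 2 = ∑ j, lam j * ∑ i, ‖Q j i‖ ^ 2 := by
        rw [Finset.sum_comm]; simp_rw [Finset.mul_sum]
    _ = ∑ i : s, ∑ j, lam j * ‖W' j i‖ ^ 2 := by
        rw [Finset.sum_comm]; simp_rw [hsum, Finset.mul_sum]
    _ ≤ ∑ i : s, ∑ j, lam i * ‖W' j i‖ ^ 2 := by
        refine Finset.sum_le_sum fun i _ => Finset.sum_le_sum fun j _ => ?_
        rcases lt_or_ge j (i : Fin n) with h | h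
        · simp [hzero j i h]
        · exact mul_le_mul_of_nonneg_right (hlam h) (sq_nonneg _)
    _ = ∑ i : s, lam i := by
        simp_rw [← Finset.mul_sum, hunit, mul_one]

/-- Abel summation: partial sums that are nonpositive pair nonpositively with an antitone weight. -/
theorem Antitone.sum_mul_le_of_prefix_nonpos {n : ℕ} {h y : Fin (n + 1) → ℝ} (hh : Antitone h)
    (hy : ∀ k : ℕ, ∑ l : Fin (n + 1), (if (l : ℕ) < k then y l else 0) ≤ 0) :
    ∑ l, h l * y l ≤ h (Fin.last n) * ∑ l, y l := by
  induction n with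
  | zero => simp
  | succ n ih =>
    have hS : ∑ l : Fin (n + 1), y l.castSucc ≤ 0 := by
      have := hy (n + 1)
      simpa [Fin.sum_univ_castSucc] using this
    have := ih (h := h ∘ Fin.castSucc) (y := y ∘ Fin.castSucc)
      (hh.comp_monotone Fin.strictMono_castSucc.monotone) fun k => by
        rcases le_or_gt k (n + 1) with hk | hk
        · have := hy k
          rw [Fin.sum_univ_castSucc] at this
          simpa [hk.not_gt] using this
        · simpa [fun l : Fin (n + 1) => l.2.trans hk] using hS
    rw [Fin.sum_univ_castSucc, Fin.sum_univ_castSucc (f := y), mul_add]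
    have h2 : h (Fin.last (n + 1)) ≤ h (Fin.castSucc (Fin.last n)) := hh (Fin.le_last _)
    simp only [Function.comp_apply] at this
    nlinarith

/-- The set of unitary matrices whose induced flag satisfies the trace inequalities against all
antitone diagonal matrices. -/
def traceBoundedUnitaries {n : ℕ} (Hv : Fin n → ℝ) : Set (Matrix (Fin n) (Fin n) ℂ) :=
  {u | uᴴ * u = 1 ∧ ∀ lam : Fin n → ℝ, Antitone lam →
    ∑ i, Hv i * ∑ j, lam j * ‖u j i‖ ^ 2 ≤ ∑ i, Hv i * lam i}

theorem exists_mem_traceBoundedUnitaries {n : ℕ} (Hv : Fin n → ℝ)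
    (X : Matrix (Fin n) (Fin n) ℂ) :
    ∃ u ∈ traceBoundedUnitaries Hv,
      ∀ i i', Hv i' < Hv i → (uᴴ * (1 + strictLower X)) i' i = 0 := by
  set σ : Equiv.Perm (Fin n) := Tuple.sort (fun i => -Hv i) with hσ
  have hanti : Antitone (Hv ∘ σ) := fun i j hij => by
    have := Tuple.monotone_sort (fun i => -Hv i) hij
    simpa using this
  have hind : LinearIndependent ℂ ((1 + strictLower X).submatrix id σ).col :=
    (linearIndependent_col_one_add_strictLower X).comp σ σ.injective
  obtain ⟨W, S, hW, hWS, hS, hWM⟩ := Matrix.exists_gramSchmidt _ hind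
  set u := W.submatrix id σ.symm with hu
  have huu : uᴴ * u = 1 := by
    ext i j
    have := congrFun (congrFun hW (σ.symm i)) (σ.symm j)
    simpa [hu, Matrix.mul_apply, Matrix.one_apply] using this
  have huu' : u * uᴴ = 1 := mul_eq_one_comm.1 huu
  have huS : u = (1 + strictLower X) * S.submatrix σ.symm σ.symm := by
    ext i j
    rw [hu, hWS]
    simp only [Matrix.submatrix_apply, Matrix.mul_apply, id]
    exact Fintype.sum_equiv σ _ _ (by simp)
  refine ⟨u, ⟨huu, fun lam hlam => ?_⟩, fun i i' h => ?_⟩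
  · rcases n with _ | n
    · simp
    have hrow : ∀ j, ∑ i, ‖u j i‖ ^ 2 = 1 := fun j => by
      have := congrFun (congrFun huu' j) j
      simp only [Matrix.mul_apply, Matrix.conjTranspose_apply, RCLike.star_def, Complex.mul_conj',
        Matrix.one_apply_eq] at this
      exact_mod_cast this
    set y : Fin (n + 1) → ℝ := fun i => ∑ j, lam j * ‖u j i‖ ^ 2 - lam i with hy
    have hytot : ∑ i, y i = 0 := by
      rw [hy, Finset.sum_sub_distrib, Finset.sum_comm]
      simp_rw [← Finset.mul_sum, hrow, mul_one, sub_self]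
    have hpre : ∀ k : ℕ, ∑ l : Fin (n + 1), (if (l : ℕ) < k then y (σ l) else 0) ≤ 0 := by
      intro k
      set s : Finset (Fin (n + 1)) := Finset.univ.filter fun i => (σ.symm i : ℕ) < k with hs
      have hsum : ∑ l : Fin (n + 1), (if (l : ℕ) < k then y (σ l) else 0) = ∑ i : s, y i := by
        rw [Finset.sum_coe_sort s y, hs, Finset.sum_filter]
        exact Fintype.sum_equiv σ _ _ (by simp)
      rw [hsum, hy, Finset.sum_sub_distrib, sub_nonpos]
      refine sum_antitone_mul_normSq_le X s (Q := u.submatrix id Subtype.val)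
        (R := S.submatrix (fun i => σ.symm i) (fun i => σ.symm i)) ?_ ?_ hlam
      · ext i j
        have := congrFun (congrFun huu i) j
        simpa [Matrix.mul_apply, Matrix.one_apply, Subtype.val_inj] using this
      · ext i j
        refine (congrFun (congrFun huS i) j).trans (.trans (.symm ?_) (Finset.sum_coe_sort s
          fun i' => (1 + strictLower X) i i' * S (σ.symm i') (σ.symm j)).symm)
        refine Finset.sum_subset (Finset.subset_univ s) fun i' _ hi' => ?_
        have hj : (σ.symm j : ℕ) < k := (Finset.mem_filter.1 j.2).2
        have hi'' : k ≤ (σ.symm i' : ℕ) := by simpa [hs] using hi'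
        rw [hS _ _ (Fin.lt_def.2 (hj.trans_le hi'')), mul_zero]
    have hle := hanti.sum_mul_le_of_prefix_nonpos hpre
    rw [Equiv.sum_comp σ y, hytot, mul_zero] at hle
    have : ∑ l, (Hv ∘ σ) l * y (σ l) = ∑ i, Hv i * y i := Equiv.sum_comp σ fun i => Hv i * y i
    rw [this] at hle
    simp only [hy, mul_sub, Finset.sum_sub_distrib] at hle
    linarith
  · have hlt : σ.symm i < σ.symm i' := by
      by_contra hcon
      have := hanti (not_lt.1 hcon)
      simp at this
      linarith
    simpa [hu, Matrix.mul_apply] using hWM _ _ hlt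

end GramSchmidt

section Closure

open scoped Kronecker Matrix

theorem isCompact_traceBoundedUnitaries {n : ℕ} (Hv : Fin n → ℝ) :
    IsCompact (traceBoundedUnitaries Hv) := by
  have hball : IsCompact (Set.univ.pi fun _ => Set.univ.pi fun _ => Metric.closedBall 0 1 :
      Set (Matrix (Fin n) (Fin n) ℂ)) :=
    isCompact_univ_pi fun _ => isCompact_univ_pi fun _ => isCompact_closedBall 0 1
  refine hball.of_isClosed_subset ?_ fun u hu i _ j _ => ?_
  · simp only [traceBoundedUnitaries, Set.ofPred_and, Set.ofPred_forall]
    refine (isClosed_eq (by fun_prop) continuous_const).inter ?_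
    exact isClosed_iInter fun lam => isClosed_iInter fun _ =>
      isClosed_le (by fun_prop) continuous_const
  · simpa using entry_norm_bound_of_unitary (Matrix.mem_unitaryGroup_iff'.2 hu.1) i j

variable {a b c : ℕ}

theorem kronecker_mulVec_apply (A : Matrix (Fin a) (Fin a) ℂ) (B : Matrix (Fin b) (Fin b) ℂ)
    (C : Matrix (Fin c) (Fin c) ℂ) (φ : Fin a × Fin b × Fin c → ℂ) (p : Fin a × Fin b × Fin c) :
    ((A ⊗ₖ (B ⊗ₖ C)) *ᵥ φ) p = ∑ q, A p.1 q.1 * (B p.2.1 q.2.1 * C p.2.2 q.2.2) * φ q :=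
  rfl

theorem continuous_kronecker_mulVec_apply {T : Type*} [TopologicalSpace T]
    {A : T → Matrix (Fin a) (Fin a) ℂ} {B : T → Matrix (Fin b) (Fin b) ℂ}
    {C : T → Matrix (Fin c) (Fin c) ℂ} {φ : T → Fin a × Fin b × Fin c → ℂ} (hA : Continuous A)
    (hB : Continuous B) (hC : Continuous C) (hφ : Continuous φ) (p : Fin a × Fin b × Fin c) :
    Continuous fun t => ((A t ⊗ₖ (B t ⊗ₖ C t)) *ᵥ φ t) p := by
  simp only [kronecker_mulVec_apply]
  exact continuous_finsetSum _ fun q _ => ((hA.matrix_elem _ _).mul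
    ((hB.matrix_elem _ _).mul (hC.matrix_elem _ _))).mul ((continuous_apply q).comp hφ)

/-- Vectors which some triple of trace-bounded unitaries rotates into nonnegative weight. -/
def nonnegRotatable (HA : Fin a → ℝ) (HB : Fin b → ℝ) (HC : Fin c → ℝ) (z : ℝ) :
    Set (Fin a × Fin b × Fin c → ℂ) :=
  {φ | ∃ uA ∈ traceBoundedUnitaries HA, ∃ uB ∈ traceBoundedUnitaries HB,
    ∃ uC ∈ traceBoundedUnitaries HC, ∀ p, HA p.1 + HB p.2.1 + HC p.2.2 + z < 0 →
      ((uAᴴ ⊗ₖ (uBᴴ ⊗ₖ uCᴴ)) *ᵥ φ) p = 0}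

theorem isClosed_nonnegRotatable (HA : Fin a → ℝ) (HB : Fin b → ℝ) (HC : Fin c → ℝ) (z : ℝ) :
    IsClosed (nonnegRotatable HA HB HC z) := by
  have := isCompact_iff_compactSpace.1 (isCompact_traceBoundedUnitaries HA)
  have := isCompact_iff_compactSpace.1 (isCompact_traceBoundedUnitaries HB)
  have := isCompact_iff_compactSpace.1 (isCompact_traceBoundedUnitaries HC)
  set S : Set ((traceBoundedUnitaries HA × traceBoundedUnitaries HB × traceBoundedUnitaries HC) ×
      (Fin a × Fin b × Fin c → ℂ)) :=
    {q | ∀ p, HA p.1 + HB p.2.1 + HC p.2.2 + z < 0 →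
      ((q.1.1.1ᴴ ⊗ₖ (q.1.2.1.1ᴴ ⊗ₖ q.1.2.2.1ᴴ)) *ᵥ q.2) p = 0} with hS
  have hclosed : IsClosed S := by
    simp only [hS, Set.ofPred_forall]
    refine isClosed_iInter fun p => isClosed_iInter fun _ => isClosed_eq ?_ continuous_const
    exact continuous_kronecker_mulVec_apply
      (continuous_subtype_val.comp (continuous_fst.comp continuous_fst)).matrix_conjTranspose
      (continuous_subtype_val.comp (continuous_fst.comp
        (continuous_snd.comp continuous_fst))).matrix_conjTranspose
      (continuous_subtype_val.comp (continuous_snd.comp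
        (continuous_snd.comp continuous_fst))).matrix_conjTranspose continuous_snd p
  convert! isClosedMap_snd_of_compactSpace S hclosed
  ext φ
  constructor
  · rintro ⟨uA, hA, uB, hB, uC, hC, h⟩
    exact ⟨⟨(⟨uA, hA⟩, ⟨uB, hB⟩, ⟨uC, hC⟩), φ⟩, h, rfl⟩
  · rintro ⟨⟨⟨⟨uA, hA⟩, ⟨uB, hB⟩, ⟨uC, hC⟩⟩, φ⟩, h, rfl⟩
    exact ⟨uA, hA, uB, hB, uC, hC, h⟩

theorem lowerOrbitMap_mem_nonnegRotatable (HA : Fin a → ℝ) (HB : Fin b → ℝ) (HC : Fin c → ℝ)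
    (z : ℝ) (X : Matrix (Fin a) (Fin a) ℂ) (Y : Matrix (Fin b) (Fin b) ℂ)
    (Z : Matrix (Fin c) (Fin c) ℂ) (y : Fin a × Fin b × Fin c → ℂ) :
    lowerOrbitMap HA HB HC z X Y Z y ∈ nonnegRotatable HA HB HC z := by
  obtain ⟨uA, hA, hA0⟩ := exists_mem_traceBoundedUnitaries HA X
  obtain ⟨uB, hB, hB0⟩ := exists_mem_traceBoundedUnitaries HB Y
  obtain ⟨uC, hC, hC0⟩ := exists_mem_traceBoundedUnitaries HC Z
  refine ⟨uA, hA, uB, hB, uC, hC, fun p hp => ?_⟩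
  rw [lowerOrbitMap, Matrix.mulVec_mulVec, ← Matrix.mul_kronecker_mul,
    ← Matrix.mul_kronecker_mul, kronecker_mulVec_apply]
  refine Finset.sum_eq_zero fun q _ => ?_
  by_cases hq : 0 ≤ HA q.1 + HB q.2.1 + HC q.2.2 + z
  · have : HA p.1 < HA q.1 ∨ HB p.2.1 < HB q.2.1 ∨ HC p.2.2 < HC q.2.2 := by
      by_contra! h
      linarith [h.1, h.2.1, h.2.2]
    rcases this with h | h | h
    · rw [hA0 _ _ h]; simp
    · rw [hB0 _ _ h]; simp
    · rw [hC0 _ _ h]; simp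
  · simp [nonnegPart, hq]

theorem mem_nonnegRotatable {HA : Fin a → ℝ} {HB : Fin b → ℝ} {HC : Fin c → ℝ} {z : ℝ}
    {ψ : Fin a × Fin b × Fin c → ℂ} (hψ : ψ ∈ weight0Space HA HB HC z)
    (hsurj : TangentSurj HA HB HC z ψ) (φ : Fin a × Fin b × Fin c → ℂ) :
    φ ∈ nonnegRotatable HA HB HC z :=
  (denseRange_lowerOrbitCoord hψ hsurj).closure_eq ▸ Set.mem_univ φ |> closure_minimal
    (Set.range_subset_iff.2 fun _ => lowerOrbitMap_mem_nonnegRotatable ..)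
    (isClosed_nonnegRotatable HA HB HC z)

end Closure

section ReducedDensity

open scoped Kronecker Matrix

variable {a b c : ℕ}

theorem gram_mul_mul_transpose {m n : Type*} [Fintype m] [DecidableEq m] [Fintype n]
    (A : Matrix n n ℂ) {B : Matrix m m ℂ} (hB : Bᴴ * B = 1) (F : Matrix n m ℂ) :
    (A * F * Bᵀ) * (A * F * Bᵀ)ᴴ = A * (F * Fᴴ) * Aᴴ := by
  have hB' : Bᵀ * Bᵀᴴ = 1 := by
    have := congrArg Matrix.transpose hB
    rwa [Matrix.transpose_mul, Matrix.transpose_one] at this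
  rw [Matrix.conjTranspose_mul, Matrix.mul_assoc, ← Matrix.mul_assoc Bᵀ, hB', Matrix.one_mul,
    Matrix.conjTranspose_mul]
  simp only [Matrix.mul_assoc]

theorem conjTranspose_kronecker_mul_self {m n : Type*} [Fintype m] [DecidableEq m] [Fintype n]
    [DecidableEq n] {A : Matrix n n ℂ} {B : Matrix m m ℂ} (hA : Aᴴ * A = 1) (hB : Bᴴ * B = 1) :
    (A ⊗ₖ B)ᴴ * (A ⊗ₖ B) = 1 := by
  rw [Matrix.conjTranspose_kronecker, ← Matrix.mul_kronecker_mul, hA, hB, Matrix.one_kronecker_one]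

theorem rhoA_kronecker_mulVec (A : Matrix (Fin a) (Fin a) ℂ) {B : Matrix (Fin b) (Fin b) ℂ}
    {C : Matrix (Fin c) (Fin c) ℂ} (hB : Bᴴ * B = 1) (hC : Cᴴ * C = 1)
    (φ : Fin a × Fin b × Fin c → ℂ) :
    rhoA ((A ⊗ₖ (B ⊗ₖ C)) *ᵥ φ) = A * rhoA φ * Aᴴ := by
  let flat (χ : Fin a × Fin b × Fin c → ℂ) : Matrix (Fin a) (Fin b × Fin c) ℂ :=
    .of fun i q => χ (i, q)
  have hrho : ∀ χ, rhoA χ = flat χ * (flat χ)ᴴ := fun χ => by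
    ext i j
    simp [flat, rhoA, Matrix.mul_apply, Fintype.sum_prod_type]
  have hflat : flat ((A ⊗ₖ (B ⊗ₖ C)) *ᵥ φ) = A * flat φ * (B ⊗ₖ C)ᵀ := by
    ext i q
    simp only [flat, Matrix.of_apply, Matrix.mul_apply, Matrix.transpose_apply, Finset.sum_mul]
    rw [kronecker_mulVec_apply, Fintype.sum_prod_type, Finset.sum_comm]
    exact Finset.sum_congr rfl fun q' _ => Finset.sum_congr rfl fun i' _ => mul_right_comm _ _ _
  rw [hrho, hrho, hflat, gram_mul_mul_transpose _ (conjTranspose_kronecker_mul_self hB hC)]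

theorem rhoB_kronecker_mulVec {A : Matrix (Fin a) (Fin a) ℂ} (B : Matrix (Fin b) (Fin b) ℂ)
    {C : Matrix (Fin c) (Fin c) ℂ} (hA : Aᴴ * A = 1) (hC : Cᴴ * C = 1)
    (φ : Fin a × Fin b × Fin c → ℂ) :
    rhoB ((A ⊗ₖ (B ⊗ₖ C)) *ᵥ φ) = B * rhoB φ * Bᴴ := by
  let flat (χ : Fin a × Fin b × Fin c → ℂ) : Matrix (Fin b) (Fin a × Fin c) ℂ :=
    .of fun j q => χ (q.1, j, q.2)
  have hrho : ∀ χ, rhoB χ = flat χ * (flat χ)ᴴ := fun χ => by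
    ext i j
    simp [flat, rhoB, Matrix.mul_apply, Fintype.sum_prod_type]
  have hflat : flat ((A ⊗ₖ (B ⊗ₖ C)) *ᵥ φ) = B * flat φ * (A ⊗ₖ C)ᵀ := by
    ext j q
    simp only [flat, Matrix.of_apply, Matrix.mul_apply, Matrix.transpose_apply, Finset.sum_mul]
    rw [kronecker_mulVec_apply, Fintype.sum_prod_type, Fintype.sum_prod_type]
    refine Finset.sum_congr rfl fun i' _ => ?_
    rw [Fintype.sum_prod_type, Finset.sum_comm]
    refine Finset.sum_congr rfl fun k' _ => Finset.sum_congr rfl fun j' _ => ?_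
    rw [Matrix.kronecker_apply]
    ring
  rw [hrho, hrho, hflat, gram_mul_mul_transpose _ (conjTranspose_kronecker_mul_self hA hC)]

theorem rhoC_kronecker_mulVec {A : Matrix (Fin a) (Fin a) ℂ} {B : Matrix (Fin b) (Fin b) ℂ}
    (C : Matrix (Fin c) (Fin c) ℂ) (hA : Aᴴ * A = 1) (hB : Bᴴ * B = 1)
    (φ : Fin a × Fin b × Fin c → ℂ) :
    rhoC ((A ⊗ₖ (B ⊗ₖ C)) *ᵥ φ) = C * rhoC φ * Cᴴ := by
  let flat (χ : Fin a × Fin b × Fin c → ℂ) : Matrix (Fin c) (Fin a × Fin b) ℂ :=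
    .of fun k q => χ (q.1, q.2, k)
  have hrho : ∀ χ, rhoC χ = flat χ * (flat χ)ᴴ := fun χ => by
    ext i j
    simp [flat, rhoC, Matrix.mul_apply, Fintype.sum_prod_type]
  have hflat : flat ((A ⊗ₖ (B ⊗ₖ C)) *ᵥ φ) = C * flat φ * (A ⊗ₖ B)ᵀ := by
    ext k q
    simp only [flat, Matrix.of_apply, Matrix.mul_apply, Matrix.transpose_apply, Finset.sum_mul]
    rw [kronecker_mulVec_apply, Fintype.sum_prod_type, Fintype.sum_prod_type]
    refine Finset.sum_congr rfl fun i' _ => ?_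
    rw [Fintype.sum_prod_type]
    refine Finset.sum_congr rfl fun j' _ => Finset.sum_congr rfl fun k' _ => ?_
    rw [Matrix.kronecker_apply]
    ring
  rw [hrho, hrho, hflat, gram_mul_mul_transpose _ (conjTranspose_kronecker_mul_self hA hB)]

theorem IsSpecDown.exists_unitary {n : ℕ} {ρ : Matrix (Fin n) (Fin n) ℂ} {lam : Fin n → ℝ}
    (h : IsSpecDown ρ lam) : ∃ k : Matrix (Fin n) (Fin n) ℂ, kᴴ * k = 1 ∧
      k * ρ * kᴴ = Matrix.diagonal fun i => (lam i : ℂ) := by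
  obtain ⟨-, hρ, σ, rfl⟩ := h
  set U : Matrix (Fin n) (Fin n) ℂ := (hρ.eigenvectorUnitary : Matrix (Fin n) (Fin n) ℂ) with hU
  have hUU : U * Uᴴ = 1 := Unitary.coe_mul_star_self hρ.eigenvectorUnitary
  have hdiag : Uᴴ * ρ * U = Matrix.diagonal fun i => (hρ.eigenvalues i : ℂ) := by
    have := hρ.conjStarAlgAut_star_eigenvectorUnitary
    rwa [Unitary.conjStarAlgAut_star_apply] at this
  refine ⟨Uᴴ.submatrix σ id, ?_, ?_⟩
  · rw [Matrix.conjTranspose_submatrix, Matrix.conjTranspose_conjTranspose,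
      Matrix.submatrix_mul_equiv, hUU, Matrix.submatrix_one _ Function.injective_id]
  · ext i j
    have := congrFun (congrFun hdiag (σ i)) (σ j)
    simpa [Matrix.mul_apply, Matrix.diagonal_apply] using this

theorem rhoA_apply_self (χ : Fin a × Fin b × Fin c → ℂ) (i : Fin a) :
    rhoA χ i i = ((∑ j, ∑ k, ‖χ (i, j, k)‖ ^ 2 : ℝ) : ℂ) := by
  simp [rhoA, Complex.mul_conj']

theorem rhoB_apply_self (χ : Fin a × Fin b × Fin c → ℂ) (j : Fin b) :
    rhoB χ j j = ((∑ i, ∑ k, ‖χ (i, j, k)‖ ^ 2 : ℝ) : ℂ) := by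
  simp [rhoB, Complex.mul_conj']

theorem rhoC_apply_self (χ : Fin a × Fin b × Fin c → ℂ) (k : Fin c) :
    rhoC χ k k = ((∑ i, ∑ j, ‖χ (i, j, k)‖ ^ 2 : ℝ) : ℂ) := by
  simp [rhoC, Complex.mul_conj']

/-- Diagonal entries of a diagonal matrix conjugated by a matrix. -/
theorem conjTranspose_mul_diagonal_mul_apply_self {n : ℕ} (u : Matrix (Fin n) (Fin n) ℂ)
    (lam : Fin n → ℝ) (i : Fin n) :
    (uᴴ * Matrix.diagonal (fun j => (lam j : ℂ)) * u) i i =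
      ((∑ j, lam j * ‖u j i‖ ^ 2 : ℝ) : ℂ) := by
  rw [Matrix.mul_apply]
  push_cast
  refine Finset.sum_congr rfl fun j _ => ?_
  rw [Matrix.mul_diagonal, Matrix.conjTranspose_apply, ← Complex.conj_mul', RCLike.star_def]
  ring

theorem sum_mul_diag_le {n : ℕ} {Hv lam r : Fin n → ℝ} {u ρ : Matrix (Fin n) (Fin n) ℂ}
    (hu : u ∈ traceBoundedUnitaries Hv) (hlam : Antitone lam)
    (hρ : ρ = uᴴ * Matrix.diagonal (fun j => (lam j : ℂ)) * u) (hr : ∀ i, ρ i i = (r i : ℂ)) :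
    ∑ i, Hv i * r i ≤ ∑ i, Hv i * lam i := by
  have hr' : ∀ i, r i = ∑ j, lam j * ‖u j i‖ ^ 2 := fun i => by
    have := hr i
    rw [hρ, conjTranspose_mul_diagonal_mul_apply_self] at this
    exact_mod_cast this.symm
  simp_rw [hr']
  exact hu.2 lam hlam

theorem sum_diag_eq {n : ℕ} {lam r : Fin n → ℝ} {u ρ : Matrix (Fin n) (Fin n) ℂ}
    (hu : uᴴ * u = 1) (hρ : ρ = uᴴ * Matrix.diagonal (fun j => (lam j : ℂ)) * u)
    (hr : ∀ i, ρ i i = (r i : ℂ)) : ∑ i, r i = ∑ i, lam i := by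
  have h : ρ.trace = ∑ i, (lam i : ℂ) := by
    rw [hρ, Matrix.mul_assoc, Matrix.trace_mul_comm, Matrix.mul_assoc, mul_eq_one_comm.1 hu,
      Matrix.mul_one, Matrix.trace_diagonal]
  simp only [Matrix.trace, Matrix.diag_apply, hr] at h
  exact_mod_cast h

/-- If every vector can be rotated into nonnegative weight by trace-bounded unitaries, then the
weight pairs nonnegatively with all local spectra. -/
theorem wtPair_nonneg_of_forall_mem_nonnegRotatable {HA : Fin a → ℝ} {HB : Fin b → ℝ}
    {HC : Fin c → ℝ} {z : ℝ} (hK : ∀ φ, φ ∈ nonnegRotatable HA HB HC z)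
    {φ : Fin a × Fin b × Fin c → ℂ} {lamA : Fin a → ℝ} {lamB : Fin b → ℝ} {lamC : Fin c → ℝ}
    (hA : IsSpecDown (rhoA φ) lamA) (hB : IsSpecDown (rhoB φ) lamB)
    (hC : IsSpecDown (rhoC φ) lamC) : 0 ≤ wtPair HA HB HC z (lamA, lamB, lamC) := by
  obtain ⟨kA, hkA, hdA⟩ := hA.exists_unitary
  obtain ⟨kB, hkB, hdB⟩ := hB.exists_unitary
  obtain ⟨kC, hkC, hdC⟩ := hC.exists_unitary
  obtain ⟨uA, huA, uB, huB, uC, huC, hzero⟩ :=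
    hK ((kA ⊗ₖ (kB ⊗ₖ kC)) *ᵥ φ)
  set χ := (uAᴴ ⊗ₖ (uBᴴ ⊗ₖ uCᴴ)) *ᵥ ((kA ⊗ₖ (kB ⊗ₖ kC)) *ᵥ φ) with hχ
  have hstar : ∀ {n : ℕ} {Hv : Fin n → ℝ} {u : Matrix (Fin n) (Fin n) ℂ},
      u ∈ traceBoundedUnitaries Hv → uᴴᴴ * uᴴ = 1 := fun hu => by
    rw [Matrix.conjTranspose_conjTranspose, mul_eq_one_comm, hu.1]
  have hρA : rhoA χ = uAᴴ * Matrix.diagonal (fun j => (lamA j : ℂ)) * uA := by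
    rw [hχ, rhoA_kronecker_mulVec _ (hstar huB) (hstar huC), rhoA_kronecker_mulVec _ hkB hkC, hdA,
      Matrix.conjTranspose_conjTranspose]
  have hρB : rhoB χ = uBᴴ * Matrix.diagonal (fun j => (lamB j : ℂ)) * uB := by
    rw [hχ, rhoB_kronecker_mulVec _ (hstar huA) (hstar huC), rhoB_kronecker_mulVec _ hkA hkC, hdB,
      Matrix.conjTranspose_conjTranspose]
  have hρC : rhoC χ = uCᴴ * Matrix.diagonal (fun j => (lamC j : ℂ)) * uC := by
    rw [hχ, rhoC_kronecker_mulVec _ (hstar huA) (hstar huB), rhoC_kronecker_mulVec _ hkA hkB, hdC,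
      Matrix.conjTranspose_conjTranspose]
  have hleA := sum_mul_diag_le huA hA.1 hρA (rhoA_apply_self χ)
  have hleB := sum_mul_diag_le huB hB.1 hρB (rhoB_apply_self χ)
  have hleC := sum_mul_diag_le huC hC.1 hρC (rhoC_apply_self χ)
  have htot := sum_diag_eq huA.1 hρA (rhoA_apply_self χ)
  have hnonneg : 0 ≤ ∑ i, ∑ j, ∑ k, (HA i + HB j + HC k + z) * ‖χ (i, j, k)‖ ^ 2 := by
    refine Finset.sum_nonneg fun i _ => Finset.sum_nonneg fun j _ => Finset.sum_nonneg fun k _ => ?_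
    rcases lt_or_ge (HA i + HB j + HC k + z) 0 with h | h
    · simp [hzero (i, j, k) h]
    · positivity
  have hsplit : ∑ i, ∑ j, ∑ k, (HA i + HB j + HC k + z) * ‖χ (i, j, k)‖ ^ 2 =
      ∑ i, HA i * (∑ j, ∑ k, ‖χ (i, j, k)‖ ^ 2) + ∑ j, HB j * (∑ i, ∑ k, ‖χ (i, j, k)‖ ^ 2) +
      ∑ k, HC k * (∑ i, ∑ j, ‖χ (i, j, k)‖ ^ 2) + z * ∑ i, ∑ j, ∑ k, ‖χ (i, j, k)‖ ^ 2 := by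
    have hB' : ∑ j, HB j * (∑ i, ∑ k, ‖χ (i, j, k)‖ ^ 2) =
        ∑ i, ∑ j, ∑ k, HB j * ‖χ (i, j, k)‖ ^ 2 := by
      rw [Finset.sum_comm]
      simp_rw [Finset.mul_sum]
    have hC' : ∑ k, HC k * (∑ i, ∑ j, ‖χ (i, j, k)‖ ^ 2) =
        ∑ i, ∑ j, ∑ k, HC k * ‖χ (i, j, k)‖ ^ 2 := by
      simp_rw [Finset.mul_sum]
      rw [Finset.sum_comm]
      exact Finset.sum_congr rfl fun i _ => Finset.sum_comm
    rw [hB', hC']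
    simp_rw [Finset.mul_sum, ← Finset.sum_add_distrib, add_mul]
  rw [hsplit, htot] at hnonneg
  simp only [wtPair]
  linarith

end ReducedDensity

/-- If the tangent map at some `ψ ∈ ℋ₀(H,z)` is surjective onto
`ℋ₋(H,z)`, then `⟨(H,z), ·⟩ ≥ 0` is a valid inequality for the Kronecker cone. -/
theorem wtPair_nonneg_of_tangent_surjective (a b c : ℕ)
    (ha : 0 < a) (hb : 0 < b) (hc : 0 < c)
    (HA : Fin a → ℝ) (HB : Fin b → ℝ) (HC : Fin c → ℝ) (z : ℝ)
    (htr : Traceless HA HB HC)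
    (ψ : Fin a × Fin b × Fin c → ℂ) (hψ : ψ ∈ weight0Space HA HB HC z)
    (hsurj : TangentSurj HA HB HC z ψ) :
    ∀ (φ : Fin a × Fin b × Fin c → ℂ) (lamA : Fin a → ℝ) (lamB : Fin b → ℝ)
      (lamC : Fin c → ℝ),
      IsSpecDown (rhoA φ) lamA → IsSpecDown (rhoB φ) lamB →
      IsSpecDown (rhoC φ) lamC →
      0 ≤ wtPair HA HB HC z (lamA, lamB, lamC) := by
  intro φ lamA lamB lamC hA hB hC
  exact wtPair_nonneg_of_forall_mem_nonnegRotatable (mem_nonnegRotatable hψ hsurj) hA hB hC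

end
end

section
/- Let 1 < a ≤ b ≤ c ≤ ab and let (H,z), with H = (H_A,H_B,H_C) traceless, be a non-trivial facet normal of C(a,b,c). Let ψ ∈ ℂ^a ⊗ ℂ^b ⊗ ℂ^c be such that ρ_A(ψ), ρ_B(ψ), ρ_C(ψ) are all diagonal with strictly decreasing diagonal entries and such that the triple λ(ψ) = (spec↓ρ_A(ψ), spec↓ρ_B(ψ), spec↓ρ_C(ψ)) satisfies ⟨(H,z), λ(ψ)⟩ = 0. Then ψ ∈ ℋ₀(H,z) and the tangent map T_ψ : 𝔫₋(H) → ℋ₋(H,z) is a linear isomorphism. -/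
open scoped BigOperators

noncomputable section

open Matrix Filter Topology

/-- A Hermitian matrix with an approximate eigenvector of norm at least one has an eigenvalue
within the norm of the residual. -/
lemma Matrix.IsHermitian.exists_abs_eigenvalues_sub_le {n : ℕ} {ρ : Matrix (Fin n) (Fin n) ℂ}
    (hρ : ρ.IsHermitian) {v r : Fin n → ℂ} {μ : ℝ} (h : ρ *ᵥ v = (μ : ℂ) • v + r)
    (hv : 1 ≤ ‖WithLp.toLp 2 v‖) :
    ∃ k, |hρ.eigenvalues k - μ| ≤ ‖WithLp.toLp 2 r‖ := by
  set V : EuclideanSpace ℂ (Fin n) := WithLp.toLp 2 v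
  set R : EuclideanSpace ℂ (Fin n) := WithLp.toLp 2 r
  have key : ∀ k, ((hρ.eigenvalues k - μ : ℝ) : ℂ) * inner ℂ (hρ.eigenvectorBasis k) V
      = inner ℂ (hρ.eigenvectorBasis k) R := by
    intro k
    have h1 : inner ℂ (hρ.eigenvectorBasis k) (WithLp.toLp 2 (ρ *ᵥ v))
        = (hρ.eigenvalues k : ℂ) * inner ℂ (hρ.eigenvectorBasis k) V := by
      have h2 := hρ.mulVec_eigenvectorBasis k
      simp only [V, EuclideanSpace.inner_eq_star_dotProduct]
      rw [dotProduct_comm, dotProduct_mulVec]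
      have h3 := star_mulVec ρ (hρ.eigenvectorBasis k)
      rw [hρ.eq] at h3
      rw [← h3, h2, star_smul, smul_dotProduct, dotProduct_comm]
      simp
    rw [h, WithLp.toLp_add, WithLp.toLp_smul, inner_add_right, inner_smul_right] at h1
    push_cast
    linear_combination -h1
  by_contra! hcon
  have hz : ∀ k, inner ℂ (hρ.eigenvectorBasis k) V = 0 := by
    have hs : ∑ k, ((hρ.eigenvalues k - μ) ^ 2 - ‖R‖ ^ 2)
        * ‖inner ℂ (hρ.eigenvectorBasis k) V‖ ^ 2 ≤ 0 := by
      have h1 := hρ.eigenvectorBasis.sum_sq_norm_inner_right V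
      have h2 := hρ.eigenvectorBasis.sum_sq_norm_inner_right R
      simp only [← key, norm_mul, mul_pow, Complex.norm_real, Real.norm_eq_abs, sq_abs] at h2
      simp only [sub_mul, Finset.sum_sub_distrib, ← Finset.mul_sum, h1, h2]
      have : 1 ≤ ‖V‖ ^ 2 := one_le_pow₀ hv
      nlinarith [sq_nonneg ‖R‖]
    have hpos : ∀ k, 0 < (hρ.eigenvalues k - μ) ^ 2 - ‖R‖ ^ 2 := fun k => by
      have := hcon k
      rw [← sq_abs (hρ.eigenvalues k - μ)]
      nlinarith [norm_nonneg R]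
    have hnn : ∀ k ∈ Finset.univ, 0 ≤ ((hρ.eigenvalues k - μ) ^ 2 - ‖R‖ ^ 2)
        * ‖inner ℂ (hρ.eigenvectorBasis k) V‖ ^ 2 := fun k _ =>
      mul_nonneg (hpos k).le (sq_nonneg _)
    intro k
    have := (Finset.sum_eq_zero_iff_of_nonneg hnn).1 (le_antisymm hs (Finset.sum_nonneg hnn)) k
      (Finset.mem_univ k)
    simpa [(hpos k).ne'] using this
  have h0 := hρ.eigenvectorBasis.sum_sq_norm_inner_right V
  have h1 : 1 ≤ ‖V‖ ^ 2 := one_le_pow₀ hv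
  simp only [hz, norm_zero, ne_eq, OfNat.ofNat_ne_zero, not_false_eq_true, zero_pow,
    Finset.sum_const_zero] at h0
  linarith

/-- Second-order perturbation theory for the spectrum of a Hermitian matrix with simple
spectrum. -/
lemma exists_isSpecDown_perturb {n : ℕ} {d : Fin n → ℝ} (hd : StrictAnti d)
    {E F : Matrix (Fin n) (Fin n) ℂ} (hE : E.IsHermitian) (hF : F.IsHermitian) :
    ∃ C : ℝ, ∀ᶠ t : ℝ in 𝓝 0, ∃ lam : Fin n → ℝ,
      IsSpecDown (diagonal (fun i => (d i : ℂ)) + (t : ℂ) • E + ((t : ℂ) ^ 2) • F) lam ∧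
      ∀ i, |lam i - (d i + t * (E i i).re
        + t ^ 2 * ((F i i).re + ∑ j, ‖E i j‖ ^ 2 / (d i - d j)))| ≤ C * |t| ^ 3 := by
  classical
  set D : Matrix (Fin n) (Fin n) ℂ := diagonal (fun i => (d i : ℂ)) with hD
  have hDH : D.IsHermitian := by
    refine isHermitian_diagonal_of_self_adjoint _ ?_
    ext i; simp
  have hρ : ∀ t : ℝ, (D + (t : ℂ) • E + ((t : ℂ) ^ 2) • F).IsHermitian := fun t =>
    (hDH.add (hE.smul (by simp [IsSelfAdjoint]))).add (hF.smul (by simp [IsSelfAdjoint]))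
  set m₁ : Fin n → ℝ := fun i => (E i i).re
  set m₂ : Fin n → ℝ := fun i => (F i i).re + ∑ j, ‖E i j‖ ^ 2 / (d i - d j)
  set e : Fin n → Fin n → ℂ := fun i => Pi.single i 1
  set u : Fin n → Fin n → ℂ := fun i j => E j i / (d i - d j) with hu
  set w : Fin n → Fin n → ℂ := fun i j =>
    ((E *ᵥ u i) j + F j i - m₁ i * u i j) / (d i - d j) with hw
  have hm₁ : ∀ i, (m₁ i : ℂ) = E i i := fun i => hE.coe_re_apply_self i
  have hne : ∀ i j, j ≠ i → (d i - d j : ℂ) ≠ 0 := fun i j hij => by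
    rw [sub_ne_zero]; exact_mod_cast fun h => hij (hd.injective h).symm
  have h0 : ∀ i, D *ᵥ e i = (d i : ℂ) • e i := fun i => by
    ext j
    by_cases hij : j = i
    · subst hij; simp [hD, e, mulVec_diagonal]
    · simp [hD, e, mulVec_diagonal, hij]
  have h1 : ∀ i, D *ᵥ u i + E *ᵥ e i = (d i : ℂ) • u i + (m₁ i : ℂ) • e i := fun i => by
    ext j
    by_cases hij : j = i
    · subst hij; simp [hD, e, mulVec_diagonal, hm₁]
    · have := hne i j hij
      simp [hD, e, mulVec_diagonal, hij, hu]
      field_simp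
      ring
  have hm₂ : ∀ i, (m₂ i : ℂ) = (E *ᵥ u i) i + F i i := fun i => by
    simp only [m₂, mulVec, dotProduct, hu]
    push_cast
    rw [show ((F i i).re : ℂ) = F i i from hF.coe_re_apply_self i, add_comm]
    congr 1
    refine Finset.sum_congr rfl fun j _ => ?_
    rw [← mul_div_assoc, ← hE.apply j i, ← Complex.mul_conj']
    rfl
  have h2 : ∀ i, D *ᵥ w i + E *ᵥ u i + F *ᵥ e i
      = (d i : ℂ) • w i + (m₁ i : ℂ) • u i + (m₂ i : ℂ) • e i := fun i => by
    ext j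
    by_cases hij : j = i
    · subst hij; simp [hD, e, mulVec_diagonal, hm₂, hu]; ring
    · have := hne i j hij
      simp [hD, e, mulVec_diagonal, hij, hw]
      field_simp
      ring
  set q₀ : Fin n → Fin n → ℂ := fun i =>
    E *ᵥ w i + F *ᵥ u i - (m₁ i : ℂ) • w i - (m₂ i : ℂ) • u i
  set q₁ : Fin n → Fin n → ℂ := fun i => F *ᵥ w i - (m₂ i : ℂ) • w i
  set μ : Fin n → ℝ → ℝ := fun i t => d i + t * m₁ i + t ^ 2 * m₂ i with hμ
  set C : ℝ := ∑ i, (‖WithLp.toLp 2 (q₀ i)‖ + ‖WithLp.toLp 2 (q₁ i)‖)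
  have near : ∀ t : ℝ, |t| ≤ 1 → ∀ i, ∃ k, |(hρ t).eigenvalues k - μ i t| ≤ C * |t| ^ 3 := by
    intro t ht i
    have hres : (D + (t : ℂ) • E + ((t : ℂ) ^ 2) • F) *ᵥ (e i + (t : ℂ) • u i + (t : ℂ) ^ 2 • w i)
        = (μ i t : ℂ) • (e i + (t : ℂ) • u i + (t : ℂ) ^ 2 • w i)
          + (t : ℂ) ^ 3 • (q₀ i + (t : ℂ) • q₁ i) := by
      simp only [add_mulVec, mulVec_add, mulVec_smul, smul_mulVec, hμ, q₀, q₁]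
      push_cast
      linear_combination (norm := module) h0 i + (t : ℂ) • h1 i + (t : ℂ) ^ 2 • h2 i
    have hnorm : 1 ≤ ‖WithLp.toLp 2 (e i + (t : ℂ) • u i + (t : ℂ) ^ 2 • w i)‖ := by
      have := PiLp.norm_apply_le
        (WithLp.toLp 2 (e i + (t : ℂ) • u i + (t : ℂ) ^ 2 • w i)) i
      simpa [e, hu, hw] using this
    obtain ⟨k, hk⟩ := (hρ t).exists_abs_eigenvalues_sub_le hres hnorm
    refine ⟨k, hk.trans ?_⟩
    rw [WithLp.toLp_smul, norm_smul, norm_pow, Complex.norm_real, Real.norm_eq_abs, mul_comm]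
    gcongr
    rw [WithLp.toLp_add, WithLp.toLp_smul]
    refine (norm_add_le _ _).trans ?_
    rw [norm_smul, Complex.norm_real, Real.norm_eq_abs]
    refine le_trans ?_ (Finset.single_le_sum
      (f := fun i => ‖WithLp.toLp 2 (q₀ i)‖ + ‖WithLp.toLp 2 (q₁ i)‖)
      (fun i _ => by positivity) (Finset.mem_univ i))
    gcongr
    exact mul_le_of_le_one_left (norm_nonneg _) ht
  have hsep : ∀ᶠ t : ℝ in 𝓝 0, ∀ i j, i < j → μ j t + C * |t| ^ 3 < μ i t - C * |t| ^ 3 := by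
    refine eventually_all.2 fun i => eventually_all.2 fun j => ?_
    by_cases hij : i < j
    · have hc₁ : Continuous fun t => μ j t + C * |t| ^ 3 := by fun_prop
      have hc₂ : Continuous fun t => μ i t - C * |t| ^ 3 := by fun_prop
      have := hc₁.continuousAt.eventually_lt (x₀ := (0 : ℝ)) hc₂.continuousAt
        (by simpa [hμ] using hd hij)
      exact this.mono fun t ht _ => ht
    · exact Eventually.of_forall fun t h => absurd h hij
  have hsmall : ∀ᶠ t : ℝ in 𝓝 0, |t| ≤ 1 := by
    have : Continuous fun t : ℝ => |t| := continuous_abs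
    exact (this.continuousAt.eventually_lt (x₀ := (0 : ℝ)) (continuousAt_const (y := (1 : ℝ)))
      (by simp)).mono fun t ht => ht.le
  refine ⟨C, ?_⟩
  filter_upwards [hsep, hsmall] with t hs ht
  choose κ hκ using near t ht
  have hanti : StrictAnti ((hρ t).eigenvalues ∘ κ) := fun i j hij => by
    have h1 := abs_le.1 (hκ i)
    have h2 := abs_le.1 (hκ j)
    have h3 := hs i j hij
    simp only [Function.comp]
    linarith
  have hinj : Function.Injective κ := fun i j h => hanti.injective (by simp [h])
  exact ⟨_, ⟨hanti.antitone, hρ t,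
    Equiv.ofBijective κ (Finite.injective_iff_bijective.1 hinj), rfl⟩, hκ⟩

/-- Necessary first- and second-order conditions at a local minimum. -/
lemma eq_zero_and_nonneg_of_eventually {f₁ f₂ C : ℝ}
    (h : ∀ᶠ t : ℝ in 𝓝 0, 0 ≤ t * f₁ + t ^ 2 * f₂ + C * |t| ^ 3) : f₁ = 0 ∧ 0 ≤ f₂ := by
  have hr : ∀ᶠ t : ℝ in 𝓝[>] 0, 0 ≤ f₁ + t * f₂ + C * t ^ 2 := by
    filter_upwards [h.filter_mono nhdsWithin_le_nhds, self_mem_nhdsWithin] with t ht ht0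
    rw [abs_of_pos ht0] at ht
    refine nonneg_of_mul_nonneg_right (b := _) (a := t) ?_ ht0
    linarith
  have hl : ∀ᶠ t : ℝ in 𝓝[<] 0, f₁ + t * f₂ - C * t ^ 2 ≤ 0 := by
    filter_upwards [h.filter_mono nhdsWithin_le_nhds, self_mem_nhdsWithin] with t ht ht0
    rw [abs_of_neg ht0] at ht
    refine nonpos_of_mul_nonneg_right (a := t) ?_ ht0
    linarith
  have hf₁ : f₁ = 0 := by
    have c₁ : Continuous fun t : ℝ => f₁ + t * f₂ + C * t ^ 2 := by fun_prop
    have c₂ : Continuous fun t : ℝ => f₁ + t * f₂ - C * t ^ 2 := by fun_prop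
    have t₁ := c₁.continuousAt (x := (0 : ℝ)).tendsto.mono_left (nhdsWithin_le_nhds (s := Set.Ioi 0))
    have t₂ := c₂.continuousAt (x := (0 : ℝ)).tendsto.mono_left (nhdsWithin_le_nhds (s := Set.Iio 0))
    have := ge_of_tendsto t₁ hr
    have := le_of_tendsto t₂ hl
    simp at *
    linarith
  refine ⟨hf₁, ?_⟩
  have hr₂ : ∀ᶠ t : ℝ in 𝓝[>] 0, 0 ≤ f₂ + C * t := by
    filter_upwards [hr, self_mem_nhdsWithin] with t ht ht0
    refine nonneg_of_mul_nonneg_right (b := _) (a := t) ?_ ht0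
    rw [hf₁] at ht
    linarith
  have c : Continuous fun t : ℝ => f₂ + C * t := by fun_prop
  have := ge_of_tendsto
    (c.continuousAt (x := (0 : ℝ)).tendsto.mono_left (nhdsWithin_le_nhds (s := Set.Ioi 0))) hr₂
  simpa using this

/-- Sign of the second-order term in the perturbation expansion of a weighted sum of eigenvalues
of `Φ * Φᴴ` under a perturbation of `Φ` by `Ψ`. -/
lemma sum_mul_second_order_nonpos {n : ℕ} {κ : Type*} [Fintype κ] {d H : Fin n → ℝ}
    (hd : StrictAnti d) {g : κ → ℝ} {Φ Ψ : Matrix (Fin n) κ ℂ}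
    (hΦ : ∀ i x, Φ i x ≠ 0 → H i + g x = 0) (hΨ : ∀ i x, Ψ i x ≠ 0 → H i + g x < 0)
    (horth : ∀ i j, i < j → H j < H i → ∑ x, Φ i x * star (Ψ j x) = 0) :
    ∑ i, H i * ∑ j, ‖(Φ * Ψᴴ + Ψ * Φᴴ) i j‖ ^ 2 / (d i - d j) ≤ 0 := by
  set E := Φ * Ψᴴ + Ψ * Φᴴ with hE
  have hEH : E.IsHermitian := by
    simp [Matrix.IsHermitian, hE, conjTranspose_add, conjTranspose_mul, add_comm]
  have hsym : ∀ i j, ‖E i j‖ = ‖E j i‖ := fun i j => by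
    rw [← hEH.apply i j, norm_star]
  have hzero : ∀ i j, i < j → H j < H i → E i j = 0 := fun i j hij hH => by
    have h2 : ∑ x, Ψ i x * star (Φ j x) = 0 := by
      refine Finset.sum_eq_zero fun x _ => ?_
      by_contra hne
      have h3 := hΨ i x (left_ne_zero_of_mul hne)
      have h4 := hΦ j x (by simpa using right_ne_zero_of_mul hne)
      linarith
    rw [hE, Matrix.add_apply]
    simp only [mul_apply, conjTranspose_apply, horth i j hij hH, h2, add_zero]
  have hlt : ∀ i j, i < j → (H i - H j) * (‖E i j‖ ^ 2 / (d i - d j)) ≤ 0 := fun i j hij => by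
    rcases le_or_gt (H i) (H j) with h | h
    · exact mul_nonpos_of_nonpos_of_nonneg (by linarith)
        (div_nonneg (sq_nonneg _) (sub_nonneg.2 (hd hij).le))
    · simp [hzero i j hij h]
  have hall : ∀ i j, (H i - H j) * (‖E i j‖ ^ 2 / (d i - d j)) ≤ 0 := fun i j => by
    rcases lt_trichotomy i j with h | h | h
    · exact hlt i j h
    · simp [h]
    · have := hlt j i h
      rw [hsym, ← neg_sub (d j), div_neg]
      linarith
  have hswap : ∑ i, ∑ j, H i * (‖E i j‖ ^ 2 / (d i - d j))
      = -∑ i, ∑ j, H j * (‖E i j‖ ^ 2 / (d i - d j)) := by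
    rw [Finset.sum_comm, ← Finset.sum_neg_distrib]
    refine Finset.sum_congr rfl fun i _ => ?_
    rw [← Finset.sum_neg_distrib]
    refine Finset.sum_congr rfl fun j _ => ?_
    rw [hsym, ← neg_sub (d i), div_neg]
    ring
  have htot : ∑ i, ∑ j, (H i - H j) * (‖E i j‖ ^ 2 / (d i - d j)) ≤ 0 :=
    Finset.sum_nonpos fun i _ => Finset.sum_nonpos fun j _ => hall i j
  simp only [sub_mul, Finset.sum_sub_distrib] at htot
  simp only [Finset.mul_sum]
  linarith

/-- The flattening of a tensor along the first factor. -/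
def flatA {a b c : ℕ} (ψ : Fin a × Fin b × Fin c → ℂ) : Matrix (Fin a) (Fin b × Fin c) ℂ :=
  Matrix.of fun i x => ψ (i, x.1, x.2)

/-- The flattening of a tensor along the second factor. -/
def flatB {a b c : ℕ} (ψ : Fin a × Fin b × Fin c → ℂ) : Matrix (Fin b) (Fin a × Fin c) ℂ :=
  Matrix.of fun j x => ψ (x.1, j, x.2)

/-- The flattening of a tensor along the third factor. -/
def flatC {a b c : ℕ} (ψ : Fin a × Fin b × Fin c → ℂ) : Matrix (Fin c) (Fin a × Fin b) ℂ :=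
  Matrix.of fun k x => ψ (x.1, x.2, k)

section

variable {a b c : ℕ} (ψ φ : Fin a × Fin b × Fin c → ℂ)

lemma rhoA_eq : rhoA ψ = flatA ψ * (flatA ψ)ᴴ := by
  ext i i'
  simp [rhoA, flatA, mul_apply, Fintype.sum_prod_type]

lemma rhoB_eq : rhoB ψ = flatB ψ * (flatB ψ)ᴴ := by
  ext i i'
  simp [rhoB, flatB, mul_apply, Fintype.sum_prod_type]

lemma rhoC_eq : rhoC ψ = flatC ψ * (flatC ψ)ᴴ := by
  ext i i'
  simp [rhoC, flatC, mul_apply, Fintype.sum_prod_type]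

end

lemma add_smul_mul_conjTranspose {m κ : Type*} [Fintype κ] (Φ Ψ : Matrix m κ ℂ) (t : ℝ) :
    (Φ + (t : ℂ) • Ψ) * (Φ + (t : ℂ) • Ψ)ᴴ
      = Φ * Φᴴ + (t : ℂ) • (Φ * Ψᴴ + Ψ * Φᴴ) + (t : ℂ) ^ 2 • (Ψ * Ψᴴ) := by
  simp only [conjTranspose_add, conjTranspose_smul, Complex.star_def, Complex.conj_ofReal,
    Matrix.add_mul, Matrix.mul_add, Matrix.mul_smul, Matrix.smul_mul, smul_smul, smul_add, pow_two]
  abel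

/-- The spectrum of `(Φ + t Ψ)(Φ + t Ψ)ᴴ` to second order in `t`. -/
lemma exists_isSpecDown_gram_perturb {n : ℕ} {κ : Type*} [Fintype κ] {d : Fin n → ℝ}
    (hd : StrictAnti d) {Φ : Matrix (Fin n) κ ℂ}
    (hΦ : Φ * Φᴴ = diagonal fun i => (d i : ℂ)) (Ψ : Matrix (Fin n) κ ℂ) :
    ∃ C : ℝ, ∀ᶠ t : ℝ in 𝓝 0, ∃ lam : Fin n → ℝ,
      IsSpecDown ((Φ + (t : ℂ) • Ψ) * (Φ + (t : ℂ) • Ψ)ᴴ) lam ∧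
      ∀ i, |lam i - (d i + t * (2 * ∑ x, (Φ i x * star (Ψ i x)).re)
        + t ^ 2 * (∑ x, ‖Ψ i x‖ ^ 2
          + ∑ j, ‖(Φ * Ψᴴ + Ψ * Φᴴ) i j‖ ^ 2 / (d i - d j)))| ≤ C * |t| ^ 3 := by
  have hE : (Φ * Ψᴴ + Ψ * Φᴴ).IsHermitian := by
    simp [Matrix.IsHermitian, conjTranspose_add, conjTranspose_mul, add_comm]
  obtain ⟨C, hC⟩ := exists_isSpecDown_perturb hd hE (isHermitian_mul_conjTranspose_self Ψ)
  refine ⟨C, hC.mono fun t ⟨lam, h1, h2⟩ => ⟨lam, ?_, fun i => ?_⟩⟩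
  · rwa [add_smul_mul_conjTranspose, hΦ]
  · have e1 : ((Φ * Ψᴴ + Ψ * Φᴴ) i i).re = 2 * ∑ x, (Φ i x * star (Ψ i x)).re := by
      simp only [Matrix.add_apply, mul_apply, conjTranspose_apply, Complex.add_re, Complex.re_sum,
        two_mul]
      congr 1
      refine Finset.sum_congr rfl fun x _ => ?_
      simp [mul_comm]
    have e2 : ((Ψ * Ψᴴ) i i).re = ∑ x, ‖Ψ i x‖ ^ 2 := by
      simp only [mul_apply, conjTranspose_apply, Complex.re_sum]
      refine Finset.sum_congr rfl fun x _ => ?_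
      rw [Complex.star_def, Complex.mul_conj']
      norm_cast
    have := h2 i
    rwa [e1, e2] at this

/-- A weighted version of the bound on the second-order expansion of the spectrum. -/
lemma exists_isSpecDown_gram_perturb_sum {n : ℕ} {κ : Type*} [Fintype κ] {d : Fin n → ℝ}
    (hd : StrictAnti d) {Φ : Matrix (Fin n) κ ℂ}
    (hΦ : Φ * Φᴴ = diagonal fun i => (d i : ℂ)) (Ψ : Matrix (Fin n) κ ℂ) (H : Fin n → ℝ) :
    ∃ C : ℝ, ∀ᶠ t : ℝ in 𝓝 0, ∃ lam : Fin n → ℝ,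
      IsSpecDown ((Φ + (t : ℂ) • Ψ) * (Φ + (t : ℂ) • Ψ)ᴴ) lam ∧
      ∑ i, H i * lam i ≤ ∑ i, H i * d i
        + t * (2 * ∑ i, ∑ x, H i * (Φ i x * star (Ψ i x)).re)
        + t ^ 2 * (∑ i, ∑ x, H i * ‖Ψ i x‖ ^ 2
          + ∑ i, H i * ∑ j, ‖(Φ * Ψᴴ + Ψ * Φᴴ) i j‖ ^ 2 / (d i - d j)) + C * |t| ^ 3 := by
  obtain ⟨C, hC⟩ := exists_isSpecDown_gram_perturb hd hΦ Ψ
  refine ⟨∑ i, |H i| * C, hC.mono fun t ⟨lam, h1, h2⟩ => ⟨lam, h1, ?_⟩⟩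
  have h3 := Finset.sum_le_sum fun i (_ : i ∈ Finset.univ) =>
    (le_abs_self _).trans ((abs_mul (H i) _).trans_le
      (mul_le_mul_of_nonneg_left (h2 i) (abs_nonneg (H i))))
  have h4 : ∑ i, |H i| * (C * |t| ^ 3) = (∑ i, |H i| * C) * |t| ^ 3 := by
    rw [Finset.sum_mul]; simp only [mul_assoc]
  rw [h4] at h3
  simp only [mul_sub, mul_add, Finset.sum_sub_distrib, Finset.sum_add_distrib] at h3
  have h5 : ∑ i, H i * (t * (2 * ∑ x, (Φ i x * star (Ψ i x)).re))
      = t * (2 * ∑ i, ∑ x, H i * (Φ i x * star (Ψ i x)).re) := by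
    simp only [← Finset.mul_sum]
    rw [Finset.mul_sum, Finset.mul_sum]
    exact Finset.sum_congr rfl fun i _ => by ring
  have h6 : ∑ i, H i * (t ^ 2 * ∑ x, ‖Ψ i x‖ ^ 2) = t ^ 2 * ∑ i, ∑ x, H i * ‖Ψ i x‖ ^ 2 := by
    simp only [← Finset.mul_sum]
    rw [Finset.mul_sum]
    exact Finset.sum_congr rfl fun i _ => by ring
  have h7 : ∑ i, H i * (t ^ 2 * ∑ j, ‖(Φ * Ψᴴ + Ψ * Φᴴ) i j‖ ^ 2 / (d i - d j))
      = t ^ 2 * ∑ i, H i * ∑ j, ‖(Φ * Ψᴴ + Ψ * Φᴴ) i j‖ ^ 2 / (d i - d j) := by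
    rw [Finset.mul_sum]
    exact Finset.sum_congr rfl fun i _ => by ring
  rw [h5, h6, h7] at h3
  linarith

lemma sum_weight_mul {a b c : ℕ} (HA : Fin a → ℝ) (HB : Fin b → ℝ) (HC : Fin c → ℝ) (z : ℝ)
    (G : Fin a × Fin b × Fin c → ℝ) :
    (∑ i, ∑ x : Fin b × Fin c, (HA i + z) * G (i, x.1, x.2))
      + (∑ j, ∑ x : Fin a × Fin c, HB j * G (x.1, j, x.2))
      + (∑ k, ∑ x : Fin a × Fin b, HC k * G (x.1, x.2, k))
      = ∑ p : Fin a × Fin b × Fin c, (HA p.1 + HB p.2.1 + HC p.2.2 + z) * G p := by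
  have hB : ∑ j, ∑ x : Fin a × Fin c, HB j * G (x.1, j, x.2)
      = ∑ i, ∑ j, ∑ k, HB j * G (i, j, k) := by
    simp only [Fintype.sum_prod_type]
    exact Finset.sum_comm
  have hC : ∑ k, ∑ x : Fin a × Fin b, HC k * G (x.1, x.2, k)
      = ∑ i, ∑ j, ∑ k, HC k * G (i, j, k) := by
    simp only [Fintype.sum_prod_type]
    rw [Finset.sum_comm]
    exact Finset.sum_congr rfl fun i _ => Finset.sum_comm
  rw [hB, hC]
  simp only [Fintype.sum_prod_type, ← Finset.sum_add_distrib]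
  exact Finset.sum_congr rfl fun i _ => Finset.sum_congr rfl fun j _ =>
    Finset.sum_congr rfl fun k _ => by ring

/-- First- and second-order optimality conditions at a preimage of a regular point on a supporting
hyperplane of the Kronecker cone. -/
lemma optimality_of_wtPair_eq_zero {a b c : ℕ}
    {HA : Fin a → ℝ} {HB : Fin b → ℝ} {HC : Fin c → ℝ} {z : ℝ}
    (hpos : ∀ lam ∈ KronCone a b c, 0 ≤ wtPair HA HB HC z lam)
    {ψ : Fin a × Fin b × Fin c → ℂ}
    {dA : Fin a → ℝ} {dB : Fin b → ℝ} {dC : Fin c → ℝ}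
    (hdA : StrictAnti dA) (hdB : StrictAnti dB) (hdC : StrictAnti dC)
    (hA : rhoA ψ = diagonal fun i => (dA i : ℂ))
    (hB : rhoB ψ = diagonal fun j => (dB j : ℂ))
    (hC : rhoC ψ = diagonal fun k => (dC k : ℂ))
    (hzero : wtPair HA HB HC z (dA, dB, dC) = 0) (φ : Fin a × Fin b × Fin c → ℂ) :
    ∑ p, (HA p.1 + HB p.2.1 + HC p.2.2 + z) * (ψ p * star (φ p)).re = 0 ∧
    0 ≤ ∑ p, (HA p.1 + HB p.2.1 + HC p.2.2 + z) * ‖φ p‖ ^ 2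
      + ∑ i, (HA i + z) * ∑ j,
        ‖(flatA ψ * (flatA φ)ᴴ + flatA φ * (flatA ψ)ᴴ) i j‖ ^ 2 / (dA i - dA j)
      + ∑ i, HB i * ∑ j,
        ‖(flatB ψ * (flatB φ)ᴴ + flatB φ * (flatB ψ)ᴴ) i j‖ ^ 2 / (dB i - dB j)
      + ∑ i, HC i * ∑ j,
        ‖(flatC ψ * (flatC φ)ᴴ + flatC φ * (flatC ψ)ᴴ) i j‖ ^ 2 / (dC i - dC j) := by
  rw [rhoA_eq] at hA
  rw [rhoB_eq] at hB
  rw [rhoC_eq] at hC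
  obtain ⟨CA, hCA⟩ := exists_isSpecDown_gram_perturb_sum hdA hA (flatA φ) (fun i => HA i + z)
  obtain ⟨CB, hCB⟩ := exists_isSpecDown_gram_perturb_sum hdB hB (flatB φ) HB
  obtain ⟨CC, hCC⟩ := exists_isSpecDown_gram_perturb_sum hdC hC (flatC φ) HC
  have e₁ := sum_weight_mul HA HB HC z fun p => (ψ p * star (φ p)).re
  have e₂ := sum_weight_mul HA HB HC z fun p => ‖φ p‖ ^ 2
  rw [← e₁, ← e₂]
  have hpair : ∀ lam, wtPair HA HB HC z lam = ∑ i, (HA i + z) * lam.1 i + ∑ j, HB j * lam.2.1 j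
      + ∑ k, HC k * lam.2.2 k := fun lam => by
    simp only [wtPair, add_mul, Finset.sum_add_distrib, Finset.mul_sum]
    ring
  rw [hpair] at hzero
  obtain ⟨h₁, h₂⟩ := eq_zero_and_nonneg_of_eventually (C := CA + CB + CC)
    (f₁ := 2 * ((∑ i, ∑ x : Fin b × Fin c, (HA i + z) * (ψ (i, x.1, x.2)
        * star (φ (i, x.1, x.2))).re)
      + (∑ j, ∑ x : Fin a × Fin c, HB j * (ψ (x.1, j, x.2) * star (φ (x.1, j, x.2))).re)
      + (∑ k, ∑ x : Fin a × Fin b, HC k * (ψ (x.1, x.2, k) * star (φ (x.1, x.2, k))).re)))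
    (f₂ := (∑ i, ∑ x : Fin b × Fin c, (HA i + z) * ‖φ (i, x.1, x.2)‖ ^ 2)
      + (∑ j, ∑ x : Fin a × Fin c, HB j * ‖φ (x.1, j, x.2)‖ ^ 2)
      + (∑ k, ∑ x : Fin a × Fin b, HC k * ‖φ (x.1, x.2, k)‖ ^ 2)
      + ∑ i, (HA i + z) * ∑ j,
        ‖(flatA ψ * (flatA φ)ᴴ + flatA φ * (flatA ψ)ᴴ) i j‖ ^ 2 / (dA i - dA j)
      + ∑ i, HB i * ∑ j,
        ‖(flatB ψ * (flatB φ)ᴴ + flatB φ * (flatB ψ)ᴴ) i j‖ ^ 2 / (dB i - dB j)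
      + ∑ i, HC i * ∑ j,
        ‖(flatC ψ * (flatC φ)ᴴ + flatC φ * (flatC ψ)ᴴ) i j‖ ^ 2 / (dC i - dC j)) (by
    filter_upwards [hCA, hCB, hCC] with t ⟨lA, sA, iA⟩ ⟨lB, sB, iB⟩ ⟨lC, sC, iC⟩
    have hmem : (lA, lB, lC) ∈ KronCone a b c := by
      refine ⟨ψ + (t : ℂ) • φ, ?_, ?_, ?_⟩
      · rw [rhoA_eq]; exact sA
      · rw [rhoB_eq]; exact sB
      · rw [rhoC_eq]; exact sC
    have := hpos _ hmem
    rw [hpair] at this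
    simp only [flatA, flatB, flatC, of_apply] at this hzero iA iB iC ⊢
    linarith)
  exact ⟨by linarith, h₂⟩

lemma sum_star_mul_sum_mul_eq {n : ℕ} {κ : Type*} [Fintype κ] {d : Fin n → ℝ}
    {Φ : Matrix (Fin n) κ ℂ} (hΦ : Φ * Φᴴ = diagonal fun i => (d i : ℂ))
    (S : Matrix (Fin n) (Fin n) ℂ) :
    ∑ i, ∑ x, star (Φ i x) * ∑ i', S i i' * Φ i' x = ∑ i, S i i * d i := by
  have h : ∀ i, ∑ x, star (Φ i x) * ∑ i', S i i' * Φ i' x = (S * (Φ * Φᴴ)) i i := fun i => by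
    rw [mul_apply]
    simp only [mul_apply, conjTranspose_apply, Finset.mul_sum]
    rw [Finset.sum_comm]
    exact Finset.sum_congr rfl fun i' _ => Finset.sum_congr rfl fun x _ => by ring
  simp only [h, hΦ, mul_diagonal]

/-- For `X` strictly lower triangular, `tr ([Xᴴ, X] D)` is nonnegative and vanishes only for
`X = 0`, if `D` is diagonal with strictly decreasing entries. -/
lemma sum_commutator_diag {n : ℕ} {d : Fin n → ℝ} (hd : StrictAnti d)
    {X : Matrix (Fin n) (Fin n) ℂ} (hX : ∀ i' i, ¬ i < i' → X i' i = 0) :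
    ∃ s : ℝ, ∑ i, (Xᴴ * X - X * Xᴴ) i i * d i = s ∧ 0 ≤ s ∧ (s = 0 → X = 0) := by
  have hterm : ∀ i' i, 0 ≤ ‖X i' i‖ ^ 2 * (d i - d i') := fun i' i => by
    by_cases h : i < i'
    · exact mul_nonneg (sq_nonneg _) (sub_nonneg.2 (hd h).le)
    · simp [hX i' i h]
  refine ⟨∑ i', ∑ i, ‖X i' i‖ ^ 2 * (d i - d i'), ?_,
    Finset.sum_nonneg fun i' _ => Finset.sum_nonneg fun i _ => hterm i' i, fun h => ?_⟩
  · have h₁ : ∑ i, (Xᴴ * X) i i * (d i : ℂ) = ∑ i', ∑ i, (‖X i' i‖ : ℂ) ^ 2 * d i := by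
      rw [Finset.sum_comm]
      refine Finset.sum_congr rfl fun i _ => ?_
      rw [mul_apply, Finset.sum_mul]
      refine Finset.sum_congr rfl fun i' _ => ?_
      rw [conjTranspose_apply, Complex.star_def, Complex.conj_mul']
    have h₂ : ∑ i, (X * Xᴴ) i i * (d i : ℂ) = ∑ i', ∑ i, (‖X i' i‖ : ℂ) ^ 2 * d i' := by
      refine Finset.sum_congr rfl fun i _ => ?_
      rw [mul_apply, Finset.sum_mul]
      refine Finset.sum_congr rfl fun i' _ => ?_
      rw [conjTranspose_apply, Complex.star_def, Complex.mul_conj']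
    simp only [Matrix.sub_apply, sub_mul, Finset.sum_sub_distrib, h₁, h₂]
    push_cast
    simp only [mul_sub, Finset.sum_sub_distrib]
  · ext i' i
    have h1 := (Finset.sum_eq_zero_iff_of_nonneg fun i' _ =>
      Finset.sum_nonneg fun i _ => hterm i' i).1 h i' (Finset.mem_univ _)
    have h2 := (Finset.sum_eq_zero_iff_of_nonneg fun i _ => hterm i' i).1 h1 i (Finset.mem_univ _)
    by_cases hi : i < i'
    · have := (sub_pos.2 (hd hi)).ne'
      simpa [this] using h2
    · exact hX i' i hi

lemma sub_kronecker {l m n p : Type*} (A₁ A₂ : Matrix l m ℂ) (B : Matrix n p ℂ) :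
    kroneckerMap (· * ·) (A₁ - A₂) B = kroneckerMap (· * ·) A₁ B - kroneckerMap (· * ·) A₂ B := by
  ext
  simp [sub_mul]

lemma kronecker_sub {l m n p : Type*} (A : Matrix l m ℂ) (B₁ B₂ : Matrix n p ℂ) :
    kroneckerMap (· * ·) A (B₁ - B₂) = kroneckerMap (· * ·) A B₁ - kroneckerMap (· * ·) A B₂ := by
  ext
  simp [mul_sub]

open Kronecker in
/-- The matrix of the infinitesimal action. -/
def actMatrix {a b c : ℕ}
    (t : Matrix (Fin a) (Fin a) ℂ × Matrix (Fin b) (Fin b) ℂ × Matrix (Fin c) (Fin c) ℂ) :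
    Matrix (Fin a × Fin b × Fin c) (Fin a × Fin b × Fin c) ℂ :=
  t.1 ⊗ₖ (1 ⊗ₖ 1) + 1 ⊗ₖ (t.2.1 ⊗ₖ 1) + 1 ⊗ₖ (1 ⊗ₖ t.2.2)

section

variable {a b c : ℕ}
  (t : Matrix (Fin a) (Fin a) ℂ × Matrix (Fin b) (Fin b) ℂ × Matrix (Fin c) (Fin c) ℂ)

lemma actMatrix_mulVec (ψ : Fin a × Fin b × Fin c → ℂ) : actMatrix t *ᵥ ψ = actL ψ t := by
  ext ⟨i, j, k⟩
  simp [actMatrix, actL, act, mulVec, dotProduct, Fintype.sum_prod_type, one_apply, add_mul,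
    Finset.sum_add_distrib, Finset.sum_ite_eq]

lemma conjTranspose_actMatrix : (actMatrix t)ᴴ = actMatrix (t.1ᴴ, t.2.1ᴴ, t.2.2ᴴ) := by
  simp [actMatrix, conjTranspose_add, conjTranspose_kronecker]

lemma actMatrix_commutator :
    (actMatrix t)ᴴ * actMatrix t - actMatrix t * (actMatrix t)ᴴ
      = actMatrix (t.1ᴴ * t.1 - t.1 * t.1ᴴ, t.2.1ᴴ * t.2.1 - t.2.1 * t.2.1ᴴ,
          t.2.2ᴴ * t.2.2 - t.2.2 * t.2.2ᴴ) := by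
  rw [conjTranspose_actMatrix]
  simp only [actMatrix, Matrix.add_mul, Matrix.mul_add, ← mul_kronecker_mul, Matrix.one_mul,
    Matrix.mul_one, sub_kronecker, kronecker_sub]
  abel

lemma star_dotProduct_actL {ψ : Fin a × Fin b × Fin c → ℂ}
    {dA : Fin a → ℝ} {dB : Fin b → ℝ} {dC : Fin c → ℝ}
    (hA : rhoA ψ = diagonal fun i => (dA i : ℂ))
    (hB : rhoB ψ = diagonal fun j => (dB j : ℂ))
    (hC : rhoC ψ = diagonal fun k => (dC k : ℂ)) :
    star ψ ⬝ᵥ actL ψ t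
      = ∑ i, t.1 i i * dA i + ∑ j, t.2.1 j j * dB j + ∑ k, t.2.2 k k * dC k := by
  rw [rhoA_eq] at hA
  rw [rhoB_eq] at hB
  rw [rhoC_eq] at hC
  rw [← sum_star_mul_sum_mul_eq hA, ← sum_star_mul_sum_mul_eq hB,
    ← sum_star_mul_sum_mul_eq hC]
  have hB' : ∀ G : Fin a × Fin b × Fin c → ℂ, ∑ j, ∑ x : Fin a × Fin c, G (x.1, j, x.2)
      = ∑ p, G p := fun G => by
    simp only [Fintype.sum_prod_type]
    exact Finset.sum_comm
  have hC' : ∀ G : Fin a × Fin b × Fin c → ℂ, ∑ k, ∑ x : Fin a × Fin b, G (x.1, x.2, k)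
      = ∑ p, G p := fun G => by
    simp only [Fintype.sum_prod_type]
    rw [Finset.sum_comm]
    exact Finset.sum_congr rfl fun i _ => Finset.sum_comm
  have hA' : ∀ G : Fin a × Fin b × Fin c → ℂ, ∑ i, ∑ x : Fin b × Fin c, G (i, x.1, x.2)
      = ∑ p, G p := fun G => (Fintype.sum_prod_type _).symm
  simp only [flatA, flatB, flatC, of_apply]
  rw [hA' fun p => star (ψ p) * ∑ i', t.1 p.1 i' * ψ (i', p.2.1, p.2.2),
    hB' fun p => star (ψ p) * ∑ j', t.2.1 p.2.1 j' * ψ (p.1, j', p.2.2),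
    hC' fun p => star (ψ p) * ∑ k', t.2.2 p.2.2 k' * ψ (p.1, p.2.1, k')]
  simp only [dotProduct, actL, act, LinearMap.coe_mk, AddHom.coe_mk, Pi.star_apply, mul_add,
    Finset.sum_add_distrib]

/-- Strictly lower triangular elements act freely on a tensor with diagonal reduced density
matrices of simple, decreasing spectrum. -/
lemma eq_zero_of_actL_eq_zero {ψ : Fin a × Fin b × Fin c → ℂ}
    {dA : Fin a → ℝ} {dB : Fin b → ℝ} {dC : Fin c → ℝ}
    (hdA : StrictAnti dA) (hdB : StrictAnti dB) (hdC : StrictAnti dC)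
    (hA : rhoA ψ = diagonal fun i => (dA i : ℂ))
    (hB : rhoB ψ = diagonal fun j => (dB j : ℂ))
    (hC : rhoC ψ = diagonal fun k => (dC k : ℂ))
    (hX : ∀ i' i, ¬ i < i' → t.1 i' i = 0) (hY : ∀ i' i, ¬ i < i' → t.2.1 i' i = 0)
    (hZ : ∀ i' i, ¬ i < i' → t.2.2 i' i = 0) (h0 : actL ψ t = 0) : t = 0 := by
  obtain ⟨x, hx, hx0, hxz⟩ := sum_commutator_diag hdA hX
  obtain ⟨y, hy, hy0, hyz⟩ := sum_commutator_diag hdB hY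
  obtain ⟨w, hw, hw0, hwz⟩ := sum_commutator_diag hdC hZ
  have h1 := star_dotProduct_actL (t.1ᴴ * t.1 - t.1 * t.1ᴴ, t.2.1ᴴ * t.2.1 - t.2.1 * t.2.1ᴴ,
    t.2.2ᴴ * t.2.2 - t.2.2 * t.2.2ᴴ) hA hB hC
  rw [hx, hy, hw, ← actMatrix_mulVec, ← actMatrix_commutator, sub_mulVec, ← mulVec_mulVec,
    actMatrix_mulVec, h0, mulVec_zero, zero_sub, dotProduct_neg, ← mulVec_mulVec,
    dotProduct_mulVec] at h1
  have h2 : star ψ ᵥ* actMatrix t = star ((actMatrix t)ᴴ *ᵥ ψ) := by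
    rw [star_mulVec, conjTranspose_conjTranspose]
  rw [h2] at h1
  have h3 : 0 ≤ (star ((actMatrix t)ᴴ *ᵥ ψ) ⬝ᵥ ((actMatrix t)ᴴ *ᵥ ψ)).re := by
    simp only [dotProduct, Pi.star_apply, Complex.re_sum, Complex.star_def, Complex.conj_mul']
    exact Finset.sum_nonneg fun p _ => by norm_cast; positivity
  have h4 := congrArg Complex.re h1
  simp only [Complex.neg_re, Complex.add_re, Complex.ofReal_re] at h4
  exact Prod.ext (hxz (by linarith)) (Prod.ext (hyz (by linarith)) (hwz (by linarith)))

end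

lemma actL_mem_weightNegSpace {a b c : ℕ}
    {HA : Fin a → ℝ} {HB : Fin b → ℝ} {HC : Fin c → ℝ} {z : ℝ}
    {ψ : Fin a × Fin b × Fin c → ℂ} (hψ : ψ ∈ weight0Space HA HB HC z)
    {t : Matrix (Fin a) (Fin a) ℂ × Matrix (Fin b) (Fin b) ℂ × Matrix (Fin c) (Fin c) ℂ}
    (ht : t ∈ nMinusMod HA HB HC) : actL ψ t ∈ weightNegSpace HA HB HC z := by
  obtain ⟨hX, hY, hZ⟩ := ht
  rintro ⟨i, j, k⟩ hp
  simp only [actL, act, LinearMap.coe_mk, AddHom.coe_mk]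
  have h0 : ∀ i j k, ψ (i, j, k) ≠ 0 → HA i + HB j + HC k + z = 0 := fun i j k h => by
    by_contra h'
    exact h (hψ (i, j, k) h')
  rw [Finset.sum_eq_zero, Finset.sum_eq_zero, Finset.sum_eq_zero]
  · simp
  · intro k' _
    by_contra h
    have h1 := h0 _ _ _ (right_ne_zero_of_mul h)
    refine left_ne_zero_of_mul h (hZ k k' fun h2 => hp ?_)
    linarith [h2.2]
  · intro j' _
    by_contra h
    have h1 := h0 _ _ _ (right_ne_zero_of_mul h)
    refine left_ne_zero_of_mul h (hY j j' fun h2 => hp ?_)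
    linarith [h2.2]
  · intro i' _
    by_contra h
    have h1 := h0 _ _ _ (right_ne_zero_of_mul h)
    refine left_ne_zero_of_mul h (hX i i' fun h2 => hp ?_)
    linarith [h2.2]

lemma single_mem_lowerMod {n : ℕ} {H : Fin n → ℝ} {i j : Fin n} (hij : i < j) (hH : H j < H i) :
    Matrix.single j i (1 : ℂ) ∈ lowerMod H := by
  intro i' i'' h
  rw [Matrix.single_apply, if_neg]
  rintro ⟨rfl, rfl⟩
  exact h ⟨hij, hH⟩

/-- A tensor of negative weight that is orthogonal to the tangent space `𝔫₋ ψ` vanishes. -/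
lemma eq_zero_of_orthogonal_tangent {a b c : ℕ}
    {HA : Fin a → ℝ} {HB : Fin b → ℝ} {HC : Fin c → ℝ} {z : ℝ}
    (hpos : ∀ lam ∈ KronCone a b c, 0 ≤ wtPair HA HB HC z lam)
    {ψ : Fin a × Fin b × Fin c → ℂ}
    {dA : Fin a → ℝ} {dB : Fin b → ℝ} {dC : Fin c → ℝ}
    (hdA : StrictAnti dA) (hdB : StrictAnti dB) (hdC : StrictAnti dC)
    (hA : rhoA ψ = diagonal fun i => (dA i : ℂ))
    (hB : rhoB ψ = diagonal fun j => (dB j : ℂ))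
    (hC : rhoC ψ = diagonal fun k => (dC k : ℂ))
    (hzero : wtPair HA HB HC z (dA, dB, dC) = 0) (hψ : ψ ∈ weight0Space HA HB HC z)
    {φ : Fin a × Fin b × Fin c → ℂ} (hφ : φ ∈ weightNegSpace HA HB HC z)
    (horth : ∀ t ∈ nMinusMod HA HB HC, ∑ p, actL ψ t p * star (φ p) = 0) : φ = 0 := by
  have h0 : ∀ p, ψ p ≠ 0 → HA p.1 + HB p.2.1 + HC p.2.2 + z = 0 := fun p h => by
    by_contra h'
    exact h (hψ p h')
  have hn : ∀ p, φ p ≠ 0 → HA p.1 + HB p.2.1 + HC p.2.2 + z < 0 := fun p h => by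
    by_contra h'
    exact h (hφ p h')
  have h2 := (optimality_of_wtPair_eq_zero hpos hdA hdB hdC hA hB hC hzero φ).2
  have sA := sum_mul_second_order_nonpos (H := fun i => HA i + z) hdA
    (g := fun x : Fin b × Fin c => HB x.1 + HC x.2) (Φ := flatA ψ) (Ψ := flatA φ)
    (fun i x h => by linarith [h0 (i, x.1, x.2) h])
    (fun i x h => by linarith [hn (i, x.1, x.2) h])
    (fun i j hij hH => by
      have h := horth (Matrix.single j i 1, 0, 0)
        ⟨single_mem_lowerMod hij (by linarith), zero_mem _, zero_mem _⟩
      simpa [actL, act, Matrix.single_apply, Fintype.sum_prod_type, flatA, ite_and] using h)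
  have sB := sum_mul_second_order_nonpos (H := HB) hdB
    (g := fun x : Fin a × Fin c => HA x.1 + HC x.2 + z) (Φ := flatB ψ) (Ψ := flatB φ)
    (fun i x h => by linarith [h0 (x.1, i, x.2) h])
    (fun i x h => by linarith [hn (x.1, i, x.2) h])
    (fun i j hij hH => by
      have h := horth (0, Matrix.single j i 1, 0)
        ⟨zero_mem _, single_mem_lowerMod hij hH, zero_mem _⟩
      simpa [actL, act, Matrix.single_apply, Fintype.sum_prod_type, flatB, ite_and] using h)
  have sC := sum_mul_second_order_nonpos (H := HC) hdC
    (g := fun x : Fin a × Fin b => HA x.1 + HB x.2 + z) (Φ := flatC ψ) (Ψ := flatC φ)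
    (fun i x h => by linarith [h0 (x.1, x.2, i) h])
    (fun i x h => by linarith [hn (x.1, x.2, i) h])
    (fun i j hij hH => by
      have h := horth (0, 0, Matrix.single j i 1)
        ⟨zero_mem _, zero_mem _, single_mem_lowerMod hij hH⟩
      simpa [actL, act, Matrix.single_apply, Fintype.sum_prod_type, flatC, ite_and] using h)
  have hterm : ∀ p ∈ Finset.univ, (HA p.1 + HB p.2.1 + HC p.2.2 + z) * ‖φ p‖ ^ 2 ≤ 0 :=
    fun p _ => by
      by_cases h : φ p = 0
      · simp [h]
      · exact mul_nonpos_of_nonpos_of_nonneg (hn p h).le (sq_nonneg _)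
  have hsum := le_antisymm (Finset.sum_nonpos hterm) (by linarith)
  ext p
  by_contra h
  have := (Finset.sum_eq_zero_iff_of_nonpos hterm).1 hsum p (Finset.mem_univ p)
  have h3 := (hn p h).ne
  have h4 : φ p ≠ 0 := h
  simp [h3, h4] at this

/-- At a preimage `ψ` of a regular point of a non-trivial facet,
`ψ ∈ ℋ₀(H,z)` and the tangent map is an isomorphism onto `ℋ₋(H,z)`. -/
theorem mem_weight0Space_and_tangentIso_of_facet (a b c : ℕ)
    (ha : 1 < a) (hab : a ≤ b) (hbc : b ≤ c) (hcab : c ≤ a * b)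
    (HA : Fin a → ℝ) (HB : Fin b → ℝ) (HC : Fin c → ℝ) (z : ℝ)
    (hfacet : IsFacetNormal a b c HA HB HC z)
    (hnt : ¬ IsTrivialNormal HA HB HC z)
    (ψ : Fin a × Fin b × Fin c → ℂ)
    (dA : Fin a → ℝ) (dB : Fin b → ℝ) (dC : Fin c → ℝ)
    (hdA : StrictAnti dA) (hdB : StrictAnti dB) (hdC : StrictAnti dC)
    (hA : rhoA ψ = Matrix.diagonal fun i => (dA i : ℂ))
    (hB : rhoB ψ = Matrix.diagonal fun j => (dB j : ℂ))
    (hC : rhoC ψ = Matrix.diagonal fun k => (dC k : ℂ))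
    (hzero : wtPair HA HB HC z (dA, dB, dC) = 0) :
    ψ ∈ weight0Space HA HB HC z ∧ TangentIso HA HB HC z ψ := by
  have hpos := hfacet.2.2.1
  have hψ : ψ ∈ weight0Space HA HB HC z := by
    have h := (optimality_of_wtPair_eq_zero hpos hdA hdB hdC hA hB hC hzero fun p =>
      ((HA p.1 + HB p.2.1 + HC p.2.2 + z : ℝ) : ℂ) * ψ p).1
    have hterm : ∀ p, (HA p.1 + HB p.2.1 + HC p.2.2 + z) * (ψ p *
        star (((HA p.1 + HB p.2.1 + HC p.2.2 + z : ℝ) : ℂ) * ψ p)).re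
        = (HA p.1 + HB p.2.1 + HC p.2.2 + z) ^ 2 * ‖ψ p‖ ^ 2 := fun p => by
      rw [star_mul, ← mul_assoc, Complex.star_def, Complex.mul_conj',
        Complex.conj_ofReal, ← Complex.ofReal_pow, ← Complex.ofReal_mul, Complex.ofReal_re]
      ring
    simp only [hterm] at h
    intro p hp
    have := (Finset.sum_eq_zero_iff_of_nonneg fun p _ => by positivity).1 h p (Finset.mem_univ p)
    simpa [hp] using this
  refine ⟨hψ, fun t ht => actL_mem_weightNegSpace hψ ht, ?_, ?_⟩
  · refine (injective_iff_map_eq_zero _).2 ?_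
    rintro ⟨t, ht⟩ h
    have h' : actL ψ t = 0 := congrArg Subtype.val h
    exact Subtype.ext (eq_zero_of_actL_eq_zero t hdA hdB hdC hA hB hC
      (fun i' i hi => ht.1 i' i fun h => hi h.1) (fun i' i hi => ht.2.1 i' i fun h => hi h.1)
      (fun i' i hi => ht.2.2 i' i fun h => hi h.1) h')
  · rintro ⟨y, hy⟩
    by_contra hcon
    have hy' : y ∉ (nMinusMod HA HB HC).map (actL ψ) := by
      rintro ⟨t, ht, rfl⟩
      exact hcon ⟨⟨t, ht⟩, rfl⟩
    obtain ⟨f, hfy, hf⟩ := Submodule.exists_le_ker_of_notMem hy'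
    classical
    set φ : Fin a × Fin b × Fin c → ℂ := fun p =>
      if HA p.1 + HB p.2.1 + HC p.2.2 + z < 0 then star (f (Pi.single p 1)) else 0
    have hrep : ∀ x ∈ weightNegSpace HA HB HC z, f x = ∑ p, x p * star (φ p) := fun x hx => by
      rw [LinearMap.pi_apply_eq_sum_univ f x]
      refine Finset.sum_congr rfl fun p _ => ?_
      by_cases hp : HA p.1 + HB p.2.1 + HC p.2.2 + z < 0
      · have hs : (fun q => if p = q then (1 : ℂ) else 0) = Pi.single p 1 := by
          ext q
          simp [Pi.single_apply, eq_comm]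
        simp [φ, hp, hs]
      · simp [hx p hp]
    have hφ := eq_zero_of_orthogonal_tangent hpos hdA hdB hdC hA hB hC hzero hψ
      (φ := φ) (fun p hp => if_neg hp) fun t ht => by
        rw [← hrep _ (actL_mem_weightNegSpace hψ ht)]
        exact hf ⟨t, ht, rfl⟩
    exact hfy (by rw [hrep y hy, hφ]; simp)

end
end

section
/- Let a, b, c be positive integers and let ψ ∈ ℂ^a ⊗ ℂ^b ⊗ ℂ^c be such that ρ_A(ψ), ρ_B(ψ), ρ_C(ψ) are all diagonal matrices with strictly decreasing diagonal entries. Then the ℝ-linear map (R_A,R_B,R_C) ↦ (R_A⊗I⊗I + I⊗R_B⊗I + I⊗I⊗R_C)ψ, defined on triples of skew-Hermitian complex matrices R_A (size a×a), R_B (size b×b), R_C (size c×c) whose diagonal entries are all zero, is injective. -/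
open scoped BigOperators

noncomputable section

/-- If `R * M + M * S = 0` with `R`, `S` skew-Hermitian, then `R` commutes with `M * Mᴴ`; hence it
vanishes if `M * Mᴴ` is diagonal with distinct entries and `R` has zero diagonal. -/
theorem skewHermitian_eq_zero_of_mul_add_mul_eq_zero {α β : Type*} [Fintype α] [DecidableEq α]
    [Fintype β] {R : Matrix α α ℂ} {S : Matrix β β ℂ} {M : Matrix α β ℂ} {d : α → ℝ}
    (hR : R.conjTranspose = -R) (hR0 : ∀ i, R i i = 0) (hS : S.conjTranspose = -S)
    (hd : Function.Injective d)
    (hM : M * M.conjTranspose = Matrix.diagonal fun i => (d i : ℂ))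
    (h : R * M + M * S = 0) : R = 0 := by
  have h1 : R * (M * M.conjTranspose) = -(M * S * M.conjTranspose) := by
    rw [← Matrix.mul_assoc, eq_neg_of_add_eq_zero_left h, Matrix.neg_mul]
  have h2 : M * M.conjTranspose * R = -(M * S * M.conjTranspose) := by
    simpa [Matrix.conjTranspose_mul, hR, hS, Matrix.mul_assoc, neg_eq_iff_eq_neg] using
      congrArg Matrix.conjTranspose h1
  have h3 := h1.trans h2.symm
  rw [hM] at h3
  ext i j
  rcases eq_or_ne i j with rfl | hij
  · simpa using hR0 i
  · have h4 := congrFun (congrFun h3 i) j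
    rw [Matrix.mul_diagonal, Matrix.diagonal_mul, mul_comm] at h4
    by_contra hne
    exact hij (hd (Complex.ofReal_injective (mul_right_cancel₀ hne h4))).symm

open scoped Kronecker in
/-- If a triple of skew-Hermitian matrices annihilates a tensor `T` whose reduced density matrix on
the first factor is diagonal with distinct entries, and the first matrix has zero diagonal, then the
first matrix vanishes. -/
theorem skewHermitian_eq_zero_of_annihilates {α β γ : Type*} [Fintype α] [DecidableEq α]
    [Fintype β] [DecidableEq β] [Fintype γ] [DecidableEq γ] {X : Matrix α α ℂ}
    {Y : Matrix β β ℂ} {Z : Matrix γ γ ℂ} (T : α → β → γ → ℂ) {d : α → ℝ}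
    (hX : X.conjTranspose = -X) (hX0 : ∀ i, X i i = 0) (hY : Y.conjTranspose = -Y)
    (hZ : Z.conjTranspose = -Z) (hd : Function.Injective d)
    (hT : ∀ i i', ∑ j, ∑ k, T i j k * (starRingEnd ℂ) (T i' j k) =
      Matrix.diagonal (fun i => (d i : ℂ)) i i')
    (h : ∀ i j k, (∑ i', X i i' * T i' j k) + (∑ j', Y j j' * T i j' k) +
      (∑ k', Z k k' * T i j k') = 0) : X = 0 := by
  refine skewHermitian_eq_zero_of_mul_add_mul_eq_zero
    (M := Matrix.of fun i (p : β × γ) => T i p.1 p.2)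
    (S := Y.transpose ⊗ₖ 1 + 1 ⊗ₖ Z.transpose) hX hX0 ?_ hd ?_ ?_
  · have hY' : Y.transpose.conjTranspose = -Y.transpose := by
      rw [← Matrix.transpose_neg, ← hY]; rfl
    have hZ' : Z.transpose.conjTranspose = -Z.transpose := by
      rw [← Matrix.transpose_neg, ← hZ]; rfl
    rw [Matrix.conjTranspose_add, Matrix.conjTranspose_kronecker, Matrix.conjTranspose_kronecker,
      hY', hZ', Matrix.conjTranspose_one, Matrix.conjTranspose_one]
    ext p q
    simp [Matrix.kroneckerMap_apply]
    ring
  · ext i i'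
    rw [← hT i i']
    simp [Matrix.mul_apply, Fintype.sum_prod_type]
  · ext i ⟨j, k⟩
    rw [Matrix.zero_apply, ← h i j k]
    simp [Matrix.mul_apply, Fintype.sum_prod_type, Matrix.kroneckerMap_apply, Matrix.one_apply,
      mul_add, Finset.sum_add_distrib, mul_comm, add_assoc]

/-- the infinitesimal action of triples of skew-Hermitian matrices
with zero diagonal is injective (over ℝ) at a `ψ` with diagonal, strictly
decreasing reduced density matrices. -/
theorem act_injOn_skewHermitian_zero_diagonal (a b c : ℕ)
    (ha : 0 < a) (hb : 0 < b) (hc : 0 < c)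
    (ψ : Fin a × Fin b × Fin c → ℂ)
    (dA : Fin a → ℝ) (dB : Fin b → ℝ) (dC : Fin c → ℝ)
    (hdA : StrictAnti dA) (hdB : StrictAnti dB) (hdC : StrictAnti dC)
    (hA : rhoA ψ = Matrix.diagonal fun i => (dA i : ℂ))
    (hB : rhoB ψ = Matrix.diagonal fun j => (dB j : ℂ))
    (hC : rhoC ψ = Matrix.diagonal fun k => (dC k : ℂ)) :
    Set.InjOn (fun t => act t ψ)
      { t : Matrix (Fin a) (Fin a) ℂ × Matrix (Fin b) (Fin b) ℂ ×
          Matrix (Fin c) (Fin c) ℂ |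
        (t.1.conjTranspose = -t.1 ∧ ∀ i, t.1 i i = 0) ∧
        (t.2.1.conjTranspose = -t.2.1 ∧ ∀ j, t.2.1 j j = 0) ∧
        (t.2.2.conjTranspose = -t.2.2 ∧ ∀ k, t.2.2 k k = 0) } := by
  rintro t ⟨⟨htA, htA0⟩, ⟨htB, htB0⟩, ⟨htC, htC0⟩⟩ s ⟨⟨hsA, hsA0⟩, ⟨hsB, hsB0⟩, ⟨hsC, hsC0⟩⟩ hts
  have skew {n : ℕ} {R S : Matrix (Fin n) (Fin n) ℂ} (hR : R.conjTranspose = -R)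
      (hS : S.conjTranspose = -S) : (R - S).conjTranspose = -(R - S) := by
    rw [Matrix.conjTranspose_sub, hR, hS]; abel
  have diag {n : ℕ} {R S : Matrix (Fin n) (Fin n) ℂ} (hR : ∀ i, R i i = 0)
      (hS : ∀ i, S i i = 0) (i : Fin n) : (R - S) i i = 0 := by
    rw [Matrix.sub_apply, hR, hS, sub_zero]
  have hA' := skew htA hsA
  have hB' := skew htB hsB
  have hC' := skew htC hsC
  have key (i : Fin a) (j : Fin b) (k : Fin c) :
      (∑ i', (t.1 - s.1) i i' * ψ (i', j, k)) + (∑ j', (t.2.1 - s.2.1) j j' * ψ (i, j', k)) +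
        (∑ k', (t.2.2 - s.2.2) k k' * ψ (i, j, k')) = 0 := by
    have h0 : actL ψ (t - s) = 0 := by rw [map_sub, sub_eq_zero]; exact hts
    exact congrFun h0 (i, j, k)
  refine Prod.ext (sub_eq_zero.mp ?_) (Prod.ext (sub_eq_zero.mp ?_) (sub_eq_zero.mp ?_))
  · exact skewHermitian_eq_zero_of_annihilates (fun i j k => ψ (i, j, k)) hA' (diag htA0 hsA0)
      hB' hC' hdA.injective (fun i i' => congrFun (congrFun hA i) i') key
  · exact skewHermitian_eq_zero_of_annihilates (fun j i k => ψ (i, j, k)) hB' (diag htB0 hsB0)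
      hA' hC' hdB.injective (fun j j' => congrFun (congrFun hB j) j')
      fun j i k => by rw [← key i j k]; ring
  · exact skewHermitian_eq_zero_of_annihilates (fun k i j => ψ (i, j, k)) hC' (diag htC0 hsC0)
      hA' hB' hdC.injective (fun k k' => congrFun (congrFun hC k) k')
      fun k i j => by rw [← key i j k]; ring

end
end
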